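/- For any k ≥ 0 there exists a constant κ = κ(k) with the following property: if (p, q) is a symmetric pair of k-similar geodesics in Γ(G, X ∪ 𝓗) and u ∈ p, v ∈ q is a pair of synchronous vertices, then dist_X(u, v) ≤ κ. -/

import Mathlib

namespace RelHyp

variable {G : Type*} [Group G] {Λ : Type*}

/-- Length of a shortest word over the alphabet `S ∪ S⁻¹` representing `g`. -/
noncomputable def wordLength (S : Set G) (g : G) : ℕ :=
  sInf {n | ∃ w : List G, w.length = n ∧ (∀ x ∈ w, x ∈ S ∨ x⁻¹ ∈ S) ∧ w.prod = g}

/-- The free product `F = (∗_λ H_λ) ∗ F(X)`. -/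
abbrev RelFree (H : Λ → Subgroup G) (X : Set G) : Type _ :=
  Monoid.Coprod (Monoid.CoprodI fun l => ↥(H l)) (FreeGroup ↥X)

/-- The canonical homomorphism `ε : F → G`. -/
def relEps (H : Λ → Subgroup G) (X : Set G) : RelFree H X →* G :=
  Monoid.Coprod.lift (Monoid.CoprodI.lift fun l => (H l).subtype)
    (FreeGroup.lift fun x => (x : G))

/-- Letters of the alphabet `X ∪ 𝓗`, where `𝓗 = ⊔_λ (H̃_λ ∖ {1})`. -/
abbrev RelLetter (H : Λ → Subgroup G) (X : Set G) : Type _ :=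
  (Σ l : Λ, {h : ↥(H l) // h ≠ 1}) ⊕ (↥X × Bool)

/-- The image of a letter in the free product `F`. -/
def RelLetter.toF {H : Λ → Subgroup G} {X : Set G} : RelLetter H X → RelFree H X
  | Sum.inl ⟨_, h⟩ => Monoid.Coprod.inl (Monoid.CoprodI.of h.1)
  | Sum.inr (x, b) => Monoid.Coprod.inr (if b then FreeGroup.of x else (FreeGroup.of x)⁻¹)

/-- The element of `G` represented by a letter. -/
def RelLetter.val {H : Λ → Subgroup G} {X : Set G} : RelLetter H X → G
  | Sum.inl ⟨_, h⟩ => (h.1 : G)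
  | Sum.inr (x, b) => if b then (x : G) else (x : G)⁻¹

/-- The index `λ` such that the letter belongs to `H̃_λ`, if any. -/
def RelLetter.hIndex {H : Λ → Subgroup G} {X : Set G} : RelLetter H X → Option Λ
  | Sum.inl ⟨l, _⟩ => some l
  | Sum.inr _ => none

/-- The element of `F` represented by a word over `X ∪ 𝓗`. -/
def wordToF {H : Λ → Subgroup G} {X : Set G} (w : List (RelLetter H X)) : RelFree H X :=
  (w.map RelLetter.toF).prod

/-- `f` is a relative isoperimetric function of the relative presentation `⟨X, H | R⟩`. -/
def IsIsoperFn (H : Λ → Subgroup G) (X : Set G) (R : Set (RelFree H X)) (f : ℕ → ℕ) : Prop :=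
  ∀ w : List (RelLetter H X), relEps H X (wordToF w) = 1 →
    ∃ k ≤ f w.length, ∃ r c : Fin k → RelFree H X,
      (∀ i, r i ∈ R) ∧ wordToF w = (List.ofFn fun i => (c i)⁻¹ * r i * c i).prod

/-- `⟨X, H | R⟩` is a finite relative presentation of `G` w.r.t. the collection `H`. -/
structure IsFiniteRelPres (H : Λ → Subgroup G) (X : Set G) (R : Set (RelFree H X)) : Prop where
  finX : X.Finite
  finR : R.Finite
  surj : Function.Surjective (relEps H X)
  ker : (relEps H X).ker = Subgroup.normalClosure R

/-- `G` is finitely presented relative to the collection of subgroups `H`. -/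
def FinitelyPresentedRel (H : Λ → Subgroup G) : Prop :=
  ∃ (X : Set G) (R : Set (RelFree H X)), IsFiniteRelPres H X R

/-- The relative area of a word representing `1`. -/
noncomputable def relArea (H : Λ → Subgroup G) (X : Set G) (R : Set (RelFree H X))
    (w : List (RelLetter H X)) : ℕ :=
  sInf {k | ∃ r c : Fin k → RelFree H X,
    (∀ i, r i ∈ R) ∧ wordToF w = (List.ofFn fun i => (c i)⁻¹ * r i * c i).prod}

/-- The relative Dehn function of the presentation `⟨X, H | R⟩`. -/
noncomputable def relDehn (H : Λ → Subgroup G) (X : Set G) (R : Set (RelFree H X))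
    (n : ℕ) : ℕ :=
  sSup {a | ∃ w : List (RelLetter H X), w.length ≤ n ∧ relEps H X (wordToF w) = 1 ∧
    a = relArea H X R w}

/-- The relative Dehn function is well-defined (finite for each value of the argument),
i.e. there exists a finite-valued relative isoperimetric function. -/
def DehnWellDefined (H : Λ → Subgroup G) (X : Set G) (R : Set (RelFree H X)) : Prop :=
  ∃ f : ℕ → ℕ, IsIsoperFn H X R f

/-- `f ⪯ g`. -/
def AsympLE (f g : ℕ → ℕ) : Prop := ∃ C K L : ℕ, ∀ n, f n ≤ C * g (K * n) + L * n

/-- `f ∼ g`. -/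
def AsympEquiv (f g : ℕ → ℕ) : Prop := AsympLE f g ∧ AsympLE g f

/-- `G` is hyperbolic relative to `H`: it admits a finite relative presentation with a
linear relative isoperimetric function. -/
def IsRelHyperbolic (H : Λ → Subgroup G) : Prop :=
  ∃ (X : Set G) (R : Set (RelFree H X)), IsFiniteRelPres H X R ∧
    ∃ A B : ℕ, IsIsoperFn H X R fun n => A * n + B

/-- The subnegative closure of `f`. -/
noncomputable def subnegClosure (f : ℕ → ℕ) (n : ℕ) : ℕ :=
  sSup {s | ∃ L : List ℕ, (∀ a ∈ L, 0 < a) ∧ L.sum = n ∧ s = (L.map f).sum}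

/-- A combinatorial path in the Cayley graph `Γ(G, X ∪ 𝓗)`: a starting vertex
together with the word labelling the path. -/
structure RelPath (H : Λ → Subgroup G) (X : Set G) where
  start : G
  word : List (RelLetter H X)

namespace RelPath

variable {H : Λ → Subgroup G} {X : Set G}

/-- The length of the path. -/
def len (p : RelPath H X) : ℕ := p.word.length

/-- The `k`-th vertex of the path. -/
def vertex (p : RelPath H X) (k : ℕ) : G :=
  p.start * ((p.word.take k).map RelLetter.val).prod

/-- The terminal vertex of the path. -/
def finish (p : RelPath H X) : G := p.vertex p.word.length

end RelPath

/-- The combinatorial metric `dist_{X ∪ 𝓗}` on `G`. -/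
noncomputable def relDist (H : Λ → Subgroup G) (X : Set G) (g h : G) : ℕ :=
  wordLength (X ∪ ⋃ l, (H l : Set G)) (g⁻¹ * h)

/-- The relative length `|g|_{X ∪ 𝓗}`. -/
noncomputable def relLen (H : Λ → Subgroup G) (X : Set G) (g : G) : ℕ :=
  wordLength (X ∪ ⋃ l, (H l : Set G)) g

/-- The word metric `dist_X` on `G`. -/
noncomputable def xDist (X : Set G) (g h : G) : ℕ := wordLength X (g⁻¹ * h)

variable {H : Λ → Subgroup G} {X : Set G}

/-- `p` is a `(λ, c)`-quasi-geodesic in `Γ(G, X ∪ 𝓗)`. -/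
def IsQuasiGeodesic (lam c : ℝ) (p : RelPath H X) : Prop :=
  ∀ i j : ℕ, i ≤ j → j ≤ p.len →
    ((j - i : ℕ) : ℝ) ≤ lam * (relDist H X (p.vertex i) (p.vertex j) : ℝ) + c

/-- `p` is a geodesic in `Γ(G, X ∪ 𝓗)`. -/
def IsGeodesic (p : RelPath H X) : Prop :=
  ∀ i j : ℕ, i ≤ j → j ≤ p.len → j - i = relDist H X (p.vertex i) (p.vertex j)

/-- The `k`-th letter of `p` is a letter of `H̃_l`. -/
def LetterIsH (p : RelPath H X) (l : Λ) (k : ℕ) : Prop :=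
  ∃ a, p.word[k]? = some a ∧ a.hIndex = some l

/-- The subpath of `p` consisting of the letters with indices `a, …, b` is an
`H_l`-component of `p` (a maximal nonempty `H_l`-subword). -/
def IsComponent (p : RelPath H X) (l : Λ) (a b : ℕ) : Prop :=
  a ≤ b ∧ b < p.len ∧ (∀ k, a ≤ k → k ≤ b → LetterIsH p l k) ∧
    (a = 0 ∨ ¬ LetterIsH p l (a - 1)) ∧ (b + 1 = p.len ∨ ¬ LetterIsH p l (b + 1))

/-- The `H_l`-components of `p` starting at index `a` and of `q` starting at `a'`
are connected (their vertices lie in the same left coset of `H_l`). -/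
def ConnectedComp (p q : RelPath H X) (l : Λ) (a a' : ℕ) : Prop :=
  (p.vertex a)⁻¹ * q.vertex a' ∈ H l

/-- `p` is a path without backtracking: all of its components are isolated. -/
def NoBacktracking (p : RelPath H X) : Prop :=
  ∀ l a b a' b', IsComponent p l a b → IsComponent p l a' b' →
    ConnectedComp p p l a a' → a = a' ∧ b = b'

/-- The `k`-th vertex of `p` is a phase vertex (not an inner vertex of a component). -/
def IsPhase (p : RelPath H X) (k : ℕ) : Prop :=
  ¬ ∃ l a b, IsComponent p l a b ∧ a < k ∧ k ≤ b

/-- `p` and `q` are `k`-similar: their endpoints are `X`-distance at most `k` apart. -/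
def Similar (k : ℝ) (p q : RelPath H X) : Prop :=
  (xDist X p.start q.start : ℝ) ≤ k ∧ (xDist X p.finish q.finish : ℝ) ≤ k

/-- The Rips thin-triangles condition for `Γ(G, X ∪ 𝓗)` with constant `δ`. -/
def RipsThin (H : Λ → Subgroup G) (X : Set G) (δ : ℝ) : Prop :=
  ∀ p q r : RelPath H X, IsGeodesic p → IsGeodesic q → IsGeodesic r →
    p.finish = q.start → q.finish = r.start → r.finish = p.start →
    ∀ i ≤ p.len, ∃ j : ℕ,
      (j ≤ q.len ∧ (relDist H X (p.vertex i) (q.vertex j) : ℝ) ≤ δ) ∨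
      (j ≤ r.len ∧ (relDist H X (p.vertex i) (r.vertex j) : ℝ) ≤ δ)

/-- The Cayley graph `Γ(G, X ∪ 𝓗)` is a hyperbolic metric space. -/
def CayleyHyperbolic (H : Λ → Subgroup G) (X : Set G) : Prop :=
  ∃ δ : ℝ, 0 ≤ δ ∧ RipsThin H X δ

/-- `R` is a relatively quasi-convex subgroup of `G`. -/
def RelQuasiconvex (H : Λ → Subgroup G) (X : Set G) (R : Subgroup G) : Prop :=
  ∃ σ : ℝ, 0 < σ ∧ ∀ p : RelPath H X, IsGeodesic p → p.start ∈ R → p.finish ∈ R →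
    ∀ k ≤ p.len, ∃ w ∈ R, (xDist X (p.vertex k) w : ℝ) ≤ σ

/-- `R` is a strongly relatively quasi-convex subgroup of `G`. -/
def StronglyRelQuasiconvex (H : Λ → Subgroup G) (X : Set G) (R : Subgroup G) : Prop :=
  RelQuasiconvex H X R ∧ ∀ (g : G) (l : Λ), {x : G | x ∈ R ∧ g * x * g⁻¹ ∈ H l}.Finite

/-- `g` is a hyperbolic element: it is not conjugate to an element of any `H_λ`. -/
def IsHypElt (H : Λ → Subgroup G) (g : G) : Prop :=
  ∀ l : Λ, ∀ x ∈ H l, ¬ IsConj g x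

end RelHyp


namespace RelHyp

section WordMetric

variable {G : Type*} [Group G] {S : Set G}

theorem wordLength_le {w : List G} (hw : ∀ x ∈ w, x ∈ S ∨ x⁻¹ ∈ S) :
    wordLength S w.prod ≤ w.length :=
  Nat.sInf_le ⟨w, rfl, hw, rfl⟩

theorem exists_word_length_eq (hS : Subgroup.closure S = ⊤) (g : G) :
    ∃ w : List G, w.length = wordLength S g ∧ (∀ x ∈ w, x ∈ S ∨ x⁻¹ ∈ S) ∧ w.prod = g := by
  have hg : g ∈ Submonoid.closure (S ∪ S⁻¹) := by
    rw [← Subgroup.closure_toSubmonoid, hS]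
    trivial
  obtain ⟨w, hw, rfl⟩ := Submonoid.exists_list_of_mem_closure hg
  exact Nat.sInf_mem (s := {n | ∃ v : List G, v.length = n ∧
    (∀ x ∈ v, x ∈ S ∨ x⁻¹ ∈ S) ∧ v.prod = w.prod}) ⟨w.length, w, rfl, hw, rfl⟩

theorem wordLength_one : wordLength S (1 : G) = 0 := by
  simpa using wordLength_le (S := S) (w := []) (by simp)

theorem wordLength_le_one {g : G} (hg : g ∈ S ∨ g⁻¹ ∈ S) : wordLength S g ≤ 1 := by
  simpa using wordLength_le (S := S) (w := [g]) (by simpa using hg)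

theorem wordLength_mul_le (hS : Subgroup.closure S = ⊤) (g h : G) :
    wordLength S (g * h) ≤ wordLength S g + wordLength S h := by
  obtain ⟨v, hv, hvS, rfl⟩ := exists_word_length_eq hS g
  obtain ⟨w, hw, hwS, rfl⟩ := exists_word_length_eq hS h
  rw [← hv, ← hw, ← List.prod_append, ← List.length_append]
  refine wordLength_le fun x hx => ?_
  rcases List.mem_append.1 hx with hx | hx
  exacts [hvS x hx, hwS x hx]

theorem wordLength_inv_le (hS : Subgroup.closure S = ⊤) (g : G) :
    wordLength S g⁻¹ ≤ wordLength S g := by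
  obtain ⟨v, hv, hvS, rfl⟩ := exists_word_length_eq hS g
  rw [← hv, List.prod_inv_reverse]
  refine (wordLength_le fun x hx => ?_).trans_eq (by simp)
  obtain ⟨y, hy, rfl⟩ : ∃ y ∈ v, y⁻¹ = x := by simpa using hx
  simpa [or_comm] using hvS y hy

/-- The word metric on `G` with respect to `S`. -/
noncomputable def wordDist (S : Set G) (g h : G) : ℕ := wordLength S (g⁻¹ * h)

theorem wordDist_self (g : G) : wordDist S g g = 0 := by
  simp [wordDist, wordLength_one]

theorem wordDist_mul_left (a g h : G) : wordDist S (a * g) (a * h) = wordDist S g h := by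
  simp [wordDist, mul_assoc]

theorem wordDist_triangle (hS : Subgroup.closure S = ⊤) (a b c : G) :
    wordDist S a c ≤ wordDist S a b + wordDist S b c := by
  simpa [wordDist, mul_assoc] using wordLength_mul_le hS (a⁻¹ * b) (b⁻¹ * c)

theorem wordDist_comm (hS : Subgroup.closure S = ⊤) (a b : G) :
    wordDist S a b = wordDist S b a := by
  refine le_antisymm ?_ ?_
  · simpa [wordDist] using wordLength_inv_le hS (b⁻¹ * a)
  · simpa [wordDist] using wordLength_inv_le hS (a⁻¹ * b)

theorem wordDist_le_one {a b : G} (h : a⁻¹ * b ∈ S ∨ (a⁻¹ * b)⁻¹ ∈ S) :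
    wordDist S a b ≤ 1 :=
  wordLength_le_one h

end WordMetric

section Walk

variable {α : Type*}

/-- `Walk r n u v`: there is an `r`-walk with `n` steps from `u` to `v`. -/
inductive Walk (r : α → α → Prop) : ℕ → α → α → Prop
  | refl (u : α) : Walk r 0 u u
  | step {n : ℕ} {u v w : α} : Walk r n u v → r v w → Walk r (n + 1) u w

variable {r s : α → α → Prop}

theorem Walk.single {u v : α} (h : r u v) : Walk r 1 u v := .step (.refl u) h

theorem Walk.trans {m n : ℕ} {u v w : α} (h : Walk r m u v) (h' : Walk r n v w) :
    Walk r (m + n) u w := by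
  induction h' with
  | refl => exact h
  | step _ hr ih => exact (ih h).step hr

theorem Walk.symm (hr : ∀ a b, r a b → r b a) {n : ℕ} {u v : α} (h : Walk r n u v) :
    Walk r n v u := by
  induction h with
  | refl u => exact .refl u
  | @step n u v w _ hvw ih =>
    rw [add_comm]
    exact (Walk.single (hr _ _ hvw)).trans ih

theorem Walk.of_seq (P : ℕ → α) {a b : ℕ} (hab : a ≤ b)
    (h : ∀ i, a ≤ i → i < b → r (P i) (P (i + 1))) : Walk r (b - a) (P a) (P b) := by
  induction b, hab using Nat.le_induction with
  | base => simpa using Walk.refl (r := r) (P a)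
  | succ b hab ih =>
    rw [Nat.succ_sub hab]
    exact (ih fun i hi hi' => h i hi (by omega)).step (h b hab (by omega))

end Walk

section WordWalk

variable {G : Type*} [Group G] {S : Set G}

/-- Every pair of points at word distance `n` is joined by a sequence of `n` generator steps. -/
theorem exists_seq (hS : Subgroup.closure S = ⊤) (u v : G) :
    ∃ P : ℕ → G, P 0 = u ∧ P (wordDist S u v) = v ∧ ∀ i < wordDist S u v,
      (P i)⁻¹ * P (i + 1) ∈ S ∨ ((P i)⁻¹ * P (i + 1))⁻¹ ∈ S := by
  obtain ⟨w, hw, hwS, hp⟩ := exists_word_length_eq hS (u⁻¹ * v)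
  refine ⟨fun i => u * (w.take i).prod, by simp, ?_, fun i hi => ?_⟩
  · simp [wordDist, ← hw, hp]
  · have hi' : i < w.length := by rw [hw]; exact hi
    beta_reduce
    rw [List.prod_take_succ w i hi']
    simpa [mul_assoc] using hwS _ (List.getElem_mem hi')

theorem exists_walk (hS : Subgroup.closure S = ⊤) (u v : G) :
    Walk (fun a b => a⁻¹ * b ∈ S ∨ (a⁻¹ * b)⁻¹ ∈ S) (wordDist S u v) u v := by
  obtain ⟨P, h0, h1, hP⟩ := exists_seq hS u v
  have := Walk.of_seq (r := fun a b => a⁻¹ * b ∈ S ∨ (a⁻¹ * b)⁻¹ ∈ S) P (Nat.zero_le _)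
    fun i _ hi => hP i hi
  rwa [h0, h1, Nat.sub_zero] at this

end WordWalk

end RelHyp

namespace RelHyp

section Cochain

variable {G : Type*} [Group G] {Λ : Type*} {H : Λ → Subgroup G} {X : Set G}

/-- A step of a path in `Γ(G, X ∪ 𝓗)`, the second coordinate recording the integral of the
cochain equal to the coboundary of `F l` on the edges of `H l` and to `ψ` on the edges of `X`. -/
def CochainEdge (H : Λ → Subgroup G) (X : Set G) (ψ : G → G → ℤ) (F : Λ → G → ℤ)
    (a b : G × ℤ) : Prop :=
  (∃ l, a.1⁻¹ * b.1 ∈ H l ∧ b.2 - a.2 = F l b.1 - F l a.1) ∨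
    ((a.1⁻¹ * b.1 ∈ X ∨ (a.1⁻¹ * b.1)⁻¹ ∈ X) ∧ b.2 - a.2 = ψ a.1 b.1)

/-- A step of `X`-length at most `N` along which the cochain given by `ψ` and `F` is defined. -/
def SmallEdge (H : Λ → Subgroup G) (X : Set G) (N : ℕ) (ψ : G → G → ℤ) (F : Λ → G → ℤ)
    (a b : G × ℤ) : Prop :=
  wordDist X a.1 b.1 ≤ N ∧
    ((∃ l, a.1⁻¹ * b.1 ∈ H l ∧ b.2 - a.2 = F l b.1 - F l a.1) ∨ b.2 - a.2 = ψ a.1 b.1)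

/-- The value of the cochain on the edge starting at `g` with a given label. -/
def letterVal (ψ : G → G → ℤ) (F : Λ → G → ℤ) : RelLetter H X → G → ℤ
  | Sum.inl ⟨l, h⟩, g => F l (g * h.1) - F l g
  | Sum.inr c, g => ψ g (g * RelLetter.val (H := H) (Sum.inr c))

/-- The integral of the cochain along the path starting at `g` with a given label. -/
def wordVal (ψ : G → G → ℤ) (F : Λ → G → ℤ) : List (RelLetter H X) → G → ℤ
  | [], _ => 0
  | a :: w, g => letterVal ψ F a g + wordVal ψ F w (g * a.val)

theorem wordVal_append (ψ : G → G → ℤ) (F : Λ → G → ℤ) (v w : List (RelLetter H X)) (g : G) :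
    wordVal ψ F (v ++ w) g =
      wordVal ψ F v g + wordVal ψ F w (g * (v.map RelLetter.val).prod) := by
  induction v generalizing g with
  | nil => simp [wordVal]
  | cons a v ih => simp [wordVal, ih, mul_assoc, add_assoc]

theorem relEps_toF (a : RelLetter H X) : relEps H X a.toF = a.val := by
  rcases a with ⟨l, h⟩ | ⟨x, b⟩
  · simp [relEps, RelLetter.toF, RelLetter.val]
  · cases b <;> simp [relEps, RelLetter.toF, RelLetter.val]

theorem relEps_wordToF (w : List (RelLetter H X)) :
    relEps H X (wordToF w) = (w.map RelLetter.val).prod := by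
  simp [wordToF, map_list_prod, Function.comp_def, relEps_toF]

theorem wordToF_append (v w : List (RelLetter H X)) :
    wordToF (v ++ w) = wordToF v * wordToF w := by
  simp [wordToF]

theorem wordToF_surjective : Function.Surjective (wordToF (H := H) (X := X)) := by
  have hmul : ∀ a b : RelFree H X, (∃ w, wordToF w = a) → (∃ w, wordToF w = b) →
      ∃ w, wordToF w = a * b := by
    rintro _ _ ⟨v, rfl⟩ ⟨w, rfl⟩
    exact ⟨v ++ w, wordToF_append v w⟩
  intro f
  induction f using Monoid.Coprod.induction_on with
  | inl m =>
    induction m using Monoid.CoprodI.induction_on with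
    | one => exact ⟨[], by simp [wordToF]⟩
    | of l h =>
      by_cases h1 : h = 1
      · exact ⟨[], by simp [wordToF, h1]⟩
      · exact ⟨[Sum.inl ⟨l, h, h1⟩], by simp [wordToF, RelLetter.toF]⟩
    | mul a b ha hb =>
      rw [map_mul]
      exact hmul _ _ ha hb
  | inr n =>
    induction n using FreeGroup.induction_on with
    | C1 => exact ⟨[], by simp [wordToF]⟩
    | of x => exact ⟨[Sum.inr (x, true)], by simp [wordToF, RelLetter.toF]⟩
    | inv_of x _ => exact ⟨[Sum.inr (x, false)], by simp [wordToF, RelLetter.toF]⟩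
    | mul a b ha hb =>
      rw [map_mul]
      exact hmul _ _ ha hb
  | mul a b ha hb => exact hmul _ _ ha hb

/-- The action of the free product `F` on `G × ℤ` which integrates the cochain along paths
traversed backwards. -/
def cochainRep (H : Λ → Subgroup G) (X : Set G) (ψ : G → G → ℤ) (F : Λ → G → ℤ)
    (hψ : ∀ u v, ψ u v = -ψ v u) : RelFree H X →* Equiv.Perm (G × ℤ) :=
  Monoid.Coprod.lift
    (Monoid.CoprodI.lift fun l =>
      { toFun := fun h =>
          { toFun := fun a => (a.1 * (h : G)⁻¹, a.2 + (F l (a.1 * (h : G)⁻¹) - F l a.1))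
            invFun := fun a => (a.1 * (h : G), a.2 + (F l (a.1 * (h : G)) - F l a.1))
            left_inv := fun a => by
              ext
              · simp
              · simp only [inv_mul_cancel_right]
                ring
            right_inv := fun a => by
              ext
              · simp
              · simp only [mul_inv_cancel_right]
                ring }
        map_one' := by ext a <;> simp
        map_mul' := fun h h' => by
          ext a
          · simp [mul_assoc]
          · simp [mul_assoc]
            ring })
    (FreeGroup.lift fun x =>
      { toFun := fun a => (a.1 * (x : G)⁻¹, a.2 + ψ a.1 (a.1 * (x : G)⁻¹))
        invFun := fun a => (a.1 * (x : G), a.2 + ψ a.1 (a.1 * (x : G)))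
        left_inv := fun a => by
          ext
          · simp
          · simp [hψ (a.1 * (x : G)⁻¹) a.1]
        right_inv := fun a => by
          ext
          · simp
          · simp [hψ (a.1 * (x : G)) a.1] })

variable {ψ : G → G → ℤ} {F : Λ → G → ℤ}

theorem cochainRep_toF (hψ : ∀ u v, ψ u v = -ψ v u) (a : RelLetter H X) (g : G) (n : ℤ) :
    cochainRep H X ψ F hψ a.toF (g * a.val, n) = (g, n - letterVal ψ F a g) := by
  rcases a with ⟨l, h⟩ | ⟨x, b⟩
  · ext <;> simp [cochainRep, RelLetter.toF, RelLetter.val, letterVal]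
    ring
  · cases b
    · rw [Prod.ext_iff]
      simp [cochainRep, RelLetter.toF, RelLetter.val, letterVal, ← Equiv.Perm.inv_def]
      refine ⟨show g * (x : G)⁻¹ * x = g by simp, ?_⟩
      change n + ψ (g * (x : G)⁻¹) (g * (x : G)⁻¹ * x) = _
      simp [hψ (g * (x : G)⁻¹) g, sub_eq_add_neg]
    · rw [Prod.ext_iff]
      simp [cochainRep, RelLetter.toF, RelLetter.val, letterVal, hψ (g * x) g]
      ring

theorem cochainRep_wordToF (hψ : ∀ u v, ψ u v = -ψ v u) (w : List (RelLetter H X)) (g : G) (n : ℤ) :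
    cochainRep H X ψ F hψ (wordToF w) (g * (w.map RelLetter.val).prod, n) =
      (g, n - wordVal ψ F w g) := by
  induction w generalizing g n with
  | nil => simp [wordToF, wordVal]
  | cons a w ih =>
    have : wordToF (a :: w) = a.toF * wordToF w := by simp [wordToF]
    rw [this, map_mul, Equiv.Perm.mul_apply, List.map_cons, List.prod_cons, ← mul_assoc, ih,
      cochainRep_toF, wordVal]
    congr 1
    ring

/-- A permutation of `α × ℤ` acting by vertical translations of size at most `D`. -/
def VerticalBy {α : Type*} (f : Equiv.Perm (α × ℤ)) (D : ℕ) : Prop :=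
  ∀ g n, ∃ e : ℤ, |e| ≤ D ∧ f (g, n) = (g, n + e)

theorem VerticalBy.list_prod {α : Type*} {D : ℕ} (L : List (Equiv.Perm (α × ℤ)))
    (h : ∀ f ∈ L, VerticalBy f D) : VerticalBy L.prod (D * L.length) := by
  induction L with
  | nil => exact fun g n => ⟨0, by simp, by simp⟩
  | cons f L ih =>
    intro g n
    obtain ⟨e, he, hf⟩ := ih (fun f hf => h f (by simp [hf])) g n
    obtain ⟨e', he', hf'⟩ := h f (by simp) g (n + e)
    refine ⟨e + e', (abs_add_le _ _).trans ?_, by simp [hf, hf', add_assoc]⟩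
    push_cast [List.length_cons] at he ⊢
    linarith

theorem verticalBy_cochainRep_conj (hψ : ∀ u v, ψ u v = -ψ v u) {D : ℕ}
    {w : List (RelLetter H X)}
    (hw : (w.map RelLetter.val).prod = 1) (hD : ∀ g, |wordVal ψ F w g| ≤ D) (c : RelFree H X) :
    VerticalBy (cochainRep H X ψ F hψ (c⁻¹ * wordToF w * c)) D := by
  intro g n
  obtain ⟨v, rfl⟩ := wordToF_surjective c
  obtain ⟨g, rfl⟩ : ∃ g', g = g' * (v.map RelLetter.val).prod :=
    ⟨g * (v.map RelLetter.val).prod⁻¹, by simp⟩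
  refine ⟨-wordVal ψ F w g, by simpa using hD g, ?_⟩
  have h1 := cochainRep_wordToF (F := F) hψ w g (n - wordVal ψ F v g)
  rw [hw, mul_one] at h1
  rw [map_mul, map_mul, map_inv, Equiv.Perm.mul_apply, Equiv.Perm.mul_apply, cochainRep_wordToF,
    h1, Equiv.Perm.inv_eq_iff_eq, cochainRep_wordToF]
  congr 1
  ring

theorem abs_wordVal_le (hψ : ∀ u v, ψ u v = -ψ v u) {R : Set (RelFree H X)} {A B D : ℕ}
    (hR : IsIsoperFn H X R fun n => A * n + B)
    (hD : ∀ r ∈ R, ∃ w : List (RelLetter H X), wordToF w = r ∧ (w.map RelLetter.val).prod = 1 ∧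
      ∀ g, |wordVal ψ F w g| ≤ D)
    (w : List (RelLetter H X)) (hw : (w.map RelLetter.val).prod = 1) (g : G) :
    |wordVal ψ F w g| ≤ D * (A * w.length + B : ℕ) := by
  obtain ⟨k, hk, r, c, hr, hrc⟩ := hR w (by rw [relEps_wordToF, hw])
  have hv : VerticalBy (cochainRep H X ψ F hψ (wordToF w)) (D * k) := by
    have := VerticalBy.list_prod (D := D)
      ((List.ofFn fun i => (c i)⁻¹ * r i * c i).map (cochainRep H X ψ F hψ)) ?_
    · rwa [← map_list_prod, ← hrc, List.length_map, List.length_ofFn] at this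
    · intro f hf
      obtain ⟨y, hy, rfl⟩ := List.mem_map.1 hf
      obtain ⟨i, rfl⟩ := (List.mem_ofFn' _ _).1 hy
      beta_reduce
      obtain ⟨v, hv, hv1, hvD⟩ := hD _ (hr i)
      rw [← hv]
      exact verticalBy_cochainRep_conj hψ hv1 hvD (c i)
  obtain ⟨e, he, hf⟩ := hv g 0
  have h1 := cochainRep_wordToF (F := F) hψ w g 0
  rw [hw, mul_one, hf] at h1
  have h2 : 0 + e = 0 - wordVal ψ F w g := congrArg Prod.snd h1
  have h3 : wordVal ψ F w g = -e := by linarith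
  rw [h3, abs_neg]
  refine he.trans ?_
  exact_mod_cast Nat.mul_le_mul_left D hk

theorem walk_smallEdge_of_word {Y : Set G} {N : ℕ} (w : List (RelLetter H X))
    (hw : ∀ a ∈ w, wordLength Y a.val ≤ N) (g : G) (n : ℤ) :
    Walk (SmallEdge H Y N ψ F) w.length (g, n)
      (g * (w.map RelLetter.val).prod, n + wordVal ψ F w g) := by
  induction w generalizing g n with
  | nil => simpa [wordVal] using Walk.refl (r := SmallEdge H Y N ψ F) (g, n)
  | cons a w ih =>
    have h1 : SmallEdge H Y N ψ F (g, n) (g * a.val, n + letterVal ψ F a g) := by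
      refine ⟨by simpa [wordDist] using hw a (by simp), ?_⟩
      rcases a with ⟨l, h⟩ | c
      · exact Or.inl ⟨l, by simp [RelLetter.val], by simp [letterVal, RelLetter.val]⟩
      · exact Or.inr (by simp [letterVal])
    have h2 := (Walk.single h1).trans
      (ih (fun b hb => hw b (by simp [hb])) (g * a.val) (n + letterVal ψ F a g))
    rw [List.length_cons, add_comm]
    simpa [wordVal, mul_assoc, add_assoc] using h2

/-- A linear relative isoperimetric inequality bounds the integral along a loop of any cochain
which is exact on the cosets of the subgroups `H l` and whose coboundary is bounded. -/
theorem exists_cochain_bound (hXfin : X.Finite) (hhyp : IsRelHyperbolic H) :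
    ∃ N C : ℕ, ∀ (ψ : G → G → ℤ) (F : Λ → G → ℤ) (D : ℕ), (∀ u v, ψ u v = -ψ v u) →
      (∀ n ≤ N, ∀ a b, Walk (SmallEdge H X N ψ F) n a b → |b.2 - a.2 - ψ a.1 b.1| ≤ D) →
      ∀ n a b, Walk (CochainEdge H X ψ F) n a b → a.1 = b.1 → |b.2 - a.2| ≤ D * C * (n + 1) := by
  obtain ⟨Y, R, hYR, A, B, hAB⟩ := hhyp
  choose σ hσ using wordToF_surjective (H := H) (X := Y)
  have hτ : ∀ s : G, ∃ w : List (RelLetter H Y), (w.map RelLetter.val).prod = s := by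
    intro s
    obtain ⟨f, rfl⟩ := hYR.surj s
    exact ⟨σ f, by rw [← relEps_wordToF, hσ]⟩
  choose τ hτ using hτ
  have hfin : (σ '' R ∪ τ '' (X ∪ X⁻¹)).Finite :=
    (hYR.finR.image σ).union ((hXfin.union hXfin.inv).image τ)
  obtain ⟨N, hN⟩ : ∃ N : ℕ, ∀ w ∈ σ '' R ∪ τ '' (X ∪ X⁻¹),
      w.length ≤ N ∧ ∀ a ∈ w, wordLength X a.val ≤ N := by
    obtain ⟨N, hN⟩ := (hfin.image fun w =>
      w.length + (w.map fun a => wordLength X a.val).sum).bddAbove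
    refine ⟨N, fun w hw => ?_⟩
    have h1 : w.length + (w.map fun a => wordLength X a.val).sum ≤ N :=
      hN (Set.mem_image_of_mem _ hw)
    refine ⟨by omega, fun a ha => ?_⟩
    have h2 := List.single_le_sum (l := w.map fun a => wordLength X a.val) (by simp) _
      (List.mem_map_of_mem ha)
    omega
  refine ⟨N, 1 + A * (N + 1) + B, fun ψ F D hψ hD n a b hwalk hab => ?_⟩
  have hword : ∀ w ∈ σ '' R ∪ τ '' (X ∪ X⁻¹), ∀ g,
      |wordVal ψ F w g - ψ g (g * (w.map RelLetter.val).prod)| ≤ D := by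
    intro w hw g
    simpa using hD _ (hN w hw).1 _ _ (walk_smallEdge_of_word w (hN w hw).2 g 0)
  have hlift : ∀ n a b, Walk (CochainEdge H X ψ F) n a b → ∃ w : List (RelLetter H Y),
      (w.map RelLetter.val).prod = a.1⁻¹ * b.1 ∧ w.length ≤ (N + 1) * n ∧
        |wordVal ψ F w a.1 - (b.2 - a.2)| ≤ D * n := by
    intro n a b h
    induction h with
    | refl a => exact ⟨[], by simp, by simp, by simp [wordVal]⟩
    | @step n a b c _ hbc ih =>
      obtain ⟨w, hw1, hw2, hw3⟩ := ih
      obtain ⟨v, hv1, hv2, hv3⟩ : ∃ v : List (RelLetter H Y),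
          (v.map RelLetter.val).prod = b.1⁻¹ * c.1 ∧ v.length ≤ N + 1 ∧
            |wordVal ψ F v b.1 - (c.2 - b.2)| ≤ D := by
        rcases hbc with ⟨l, hl, hval⟩ | ⟨hs, hval⟩
        · by_cases h1 : b.1⁻¹ * c.1 = 1
          · refine ⟨[], by simp [h1], by simp, ?_⟩
            rw [inv_mul_eq_one] at h1
            simp [hval, h1, wordVal]
          · refine ⟨[Sum.inl ⟨l, ⟨_, hl⟩, fun h => h1 (congrArg Subtype.val h)⟩],
              by simp [RelLetter.val], by simp, by simp [wordVal, letterVal, hval]⟩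
        · have hm : τ (b.1⁻¹ * c.1) ∈ σ '' R ∪ τ '' (X ∪ X⁻¹) :=
            Or.inr (Set.mem_image_of_mem _ hs)
          refine ⟨τ (b.1⁻¹ * c.1), hτ _, (hN _ hm).1.trans (Nat.le_succ N), ?_⟩
          simpa [hτ, hval] using hword _ hm b.1
      refine ⟨w ++ v, by simp [hw1, hv1, mul_assoc], ?_, ?_⟩
      · rw [List.length_append]
        linarith
      · rw [wordVal_append, hw1, mul_inv_cancel_left]
        have : wordVal ψ F w a.1 + wordVal ψ F v b.1 - (c.2 - a.2) =
            (wordVal ψ F w a.1 - (b.2 - a.2)) + (wordVal ψ F v b.1 - (c.2 - b.2)) := by ring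
        rw [this]
        refine (abs_add_le _ _).trans ?_
        push_cast
        linarith
  obtain ⟨w, hw1, hw2, hw3⟩ := hlift n a b hwalk
  have hψ0 : ∀ g, ψ g g = 0 := fun g => by linarith [hψ g g]
  have h1 := abs_wordVal_le (D := D) hψ hAB (fun r hr => by
    have h1 : ((σ r).map RelLetter.val).prod = 1 := by
      rw [← relEps_wordToF, hσ, ← MonoidHom.mem_ker, hYR.ker]
      exact Subgroup.subset_normalClosure hr
    refine ⟨σ r, hσ r, h1, fun g => ?_⟩
    simpa [h1, hψ0] using hword _ (Or.inl (Set.mem_image_of_mem _ hr)) g) w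
    (by simp [hw1, hab]) a.1
  have h2 : (D : ℤ) * (A * w.length + B : ℕ) ≤ D * (A * ((N + 1) * n) + B : ℕ) := by
    gcongr
  have h3 : |b.2 - a.2| ≤ D * n + D * (A * ((N + 1) * n) + B : ℕ) := by
    rw [abs_le] at hw3 h1 ⊢
    constructor <;> linarith
  have h4 : D * n + D * (A * ((N + 1) * n) + B) ≤ D * (1 + A * (N + 1) + B) * (n + 1) := by
    have h5 : 0 ≤ D * (1 + A * (N + 1) + B * n) := Nat.zero_le _
    nlinarith
  exact h3.trans (by exact_mod_cast h4)

end Cochain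

end RelHyp

namespace RelHyp

section WalkLift

variable {α : Type*} {r s : α → α → Prop}

theorem Walk.mono (hrs : ∀ a b, r a b → s a b) {n : ℕ} {u v : α} (h : Walk r n u v) :
    Walk s n u v := by
  induction h with
  | refl u => exact .refl u
  | step _ hr ih => exact ih.step (hrs _ _ hr)

/-- Walks lift along a covering by `α × ℤ` when steps do, with control of the increment. -/
theorem Walk.lift {E : α × ℤ → α × ℤ → Prop} {lo hi : ℤ}
    (h : ∀ u v, r u v → ∃ y, lo ≤ y ∧ y ≤ hi ∧ ∀ c, E (u, c) (v, c + y))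
    {n : ℕ} {u v : α} (hw : Walk r n u v) :
    ∃ z, lo * n ≤ z ∧ z ≤ hi * n ∧ ∀ c, Walk E n (u, c) (v, c + z) := by
  induction hw with
  | refl u => exact ⟨0, by simp, by simp, fun c => by simpa using Walk.refl (u, c)⟩
  | @step n u v w _ hr ih =>
    obtain ⟨z, h1, h2, h3⟩ := ih
    obtain ⟨y, h4, h5, h6⟩ := h v w hr
    refine ⟨z + y, ?_, ?_, fun c => ?_⟩
    · push_cast
      linarith
    · push_cast
      linarith
    · rw [← add_assoc]
      exact (h3 c).step (h6 _)

end WalkLift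

section Isolated

variable {G : Type*} [Group G] {Λ : Type*} {H : Λ → Subgroup G} {X : Set G}

/-- The generating set `X ∪ 𝓗`. -/
def relGens (H : Λ → Subgroup G) (X : Set G) : Set G := X ∪ ⋃ l, (H l : Set G)

theorem closure_relGens (hX : Subgroup.closure X = ⊤) :
    Subgroup.closure (relGens H X) = ⊤ :=
  top_le_iff.1 (hX ▸ Subgroup.closure_mono Set.subset_union_left)

theorem mem_or_of_relGens {g : G} (hg : g ∈ relGens H X ∨ g⁻¹ ∈ relGens H X) :
    (g ∈ X ∨ g⁻¹ ∈ X) ∨ ∃ l, g ∈ H l := by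
  rcases hg with (h | h) | (h | h)
  · exact Or.inl (Or.inl h)
  · exact Or.inr (Set.mem_iUnion.1 h)
  · exact Or.inl (Or.inr h)
  · obtain ⟨l, hl⟩ := Set.mem_iUnion.1 h
    exact Or.inr ⟨l, inv_inv g ▸ (H l).inv_mem hl⟩

theorem relGens_dist_le_one {u v : G} {l : Λ} (h : u⁻¹ * v ∈ H l) :
    wordDist (relGens H X) u v ≤ 1 :=
  wordDist_le_one (Or.inl (Or.inr (Set.mem_iUnion.2 ⟨l, h⟩)))

theorem relGens_dist_le (hX : Subgroup.closure X = ⊤) (u v : G) :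
    wordDist (relGens H X) u v ≤ wordDist X u v := by
  obtain ⟨w, hw, hwS, hp⟩ := exists_word_length_eq hX (u⁻¹ * v)
  rw [wordDist, wordDist, ← hw, ← hp]
  exact wordLength_le fun x hx => (hwS x hx).imp Or.inl Or.inl

theorem mul_inv_mem_trans {K : Subgroup G} {a b c : G} (h : a⁻¹ * b ∈ K) (h' : b⁻¹ * c ∈ K) :
    a⁻¹ * c ∈ K := by
  simpa [mul_assoc] using K.mul_mem h h'

theorem inv_mul_mem_symm {K : Subgroup G} {a b : G} (h : a⁻¹ * b ∈ K) : b⁻¹ * a ∈ K := by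
  simpa using K.inv_mem h

/-- An edge of `Γ(G, X ∪ 𝓗)` which is not an edge of `X`-length more than `M` in the coset of
`H l` containing `x`. -/
def AvoidEdge (H : Λ → Subgroup G) (X : Set G) (l : Λ) (x : G) (M : ℕ) (u v : G) : Prop :=
  (u⁻¹ * v ∈ X ∨ (u⁻¹ * v)⁻¹ ∈ X) ∨
    ∃ μ, u⁻¹ * v ∈ H μ ∧ (μ = l → x⁻¹ * u ∉ H l ∨ wordDist X u v ≤ M)

theorem AvoidEdge.symm (hX : Subgroup.closure X = ⊤) {l : Λ} {x : G} {M : ℕ} (u v : G)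
    (h : AvoidEdge H X l x M u v) : AvoidEdge H X l x M v u := by
  rcases h with h | ⟨μ, hμ, h⟩
  · left
    simpa [or_comm] using h
  · refine Or.inr ⟨μ, inv_mul_mem_symm hμ, ?_⟩
    rintro rfl
    rcases h rfl with h | h
    · exact Or.inl fun h' => h (mul_inv_mem_trans h' (inv_mul_mem_symm hμ))
    · exact Or.inr (wordDist_comm hX u v ▸ h)

theorem AvoidEdge.of_base {l : Λ} {x y : G} {M : ℕ} (hxy : x⁻¹ * y ∈ H l) (u v : G)
    (h : AvoidEdge H X l x M u v) : AvoidEdge H X l y M u v := by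
  rcases h with h | ⟨μ, hμ, h⟩
  · exact Or.inl h
  · exact Or.inr ⟨μ, hμ, fun hl => (h hl).imp_left fun h h' => h (mul_inv_mem_trans hxy h')⟩

/-- Two points of a coset of `H l` joined by a short path without long edges in this coset are
close with respect to `X`. -/
theorem exists_isolated_bound (hX : Subgroup.closure X = ⊤) (hXfin : X.Finite)
    (hhyp : IsRelHyperbolic H) :
    ∃ C : ℕ, ∀ (l : Λ) (x : G) (M n : ℕ) (u v : G), Walk (AvoidEdge H X l x M) n u v →
      x⁻¹ * u ∈ H l → x⁻¹ * v ∈ H l → wordDist X u v ≤ M * n + C * (n + 2) := by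
  classical
  obtain ⟨N, C, hC⟩ := exists_cochain_bound hXfin hhyp
  refine ⟨N * N * C, fun l x M n u v hw hu hv => ?_⟩
  replace hw := hw.mono (AvoidEdge.of_base hu)
  replace hv := mul_inv_mem_trans (inv_mul_mem_symm hu) hv
  let F : Λ → G → ℤ := fun μ g => if μ = l ∧ u⁻¹ * g ∈ H l then (wordDist X u g : ℤ) else 0
  have hF : ∀ μ a b, a⁻¹ * b ∈ H μ → |F μ b - F μ a| ≤ wordDist X a b := by
    intro μ a b hab
    by_cases hμ : μ = l
    · subst hμ
      by_cases ha : u⁻¹ * a ∈ H μ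
      · have hb : u⁻¹ * b ∈ H μ := mul_inv_mem_trans ha hab
        have h1 := wordDist_triangle hX u a b
        have h2 := wordDist_triangle hX u b a
        rw [wordDist_comm hX b a] at h2
        simp only [F, ha, hb, and_self, if_true]
        rw [abs_le]
        constructor <;> linarith
      · have hb : u⁻¹ * b ∉ H μ := fun hb => ha (mul_inv_mem_trans hb (inv_mul_mem_symm hab))
        simp [F, ha, hb]
    · simp [F, hμ]
  have hD : ∀ n ≤ N, ∀ a b, Walk (SmallEdge H X N (fun _ _ => 0) F) n a b →
      |b.2 - a.2 - 0| ≤ (N * N : ℕ) := by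
    have : ∀ n a b, Walk (SmallEdge H X N (fun _ _ => 0) F) n a b → |b.2 - a.2| ≤ n * N := by
      intro n a b h
      induction h with
      | refl a => simp
      | @step n a b c _ hbc ih =>
        have h1 : |c.2 - b.2| ≤ N := by
          rcases hbc with ⟨hN, ⟨μ, hμ, h⟩ | h⟩
          · rw [h]
            exact (hF μ _ _ hμ).trans (by exact_mod_cast hN)
          · simp [h]
        have := abs_add_le (b.2 - a.2) (c.2 - b.2)
        rw [show c.2 - a.2 = b.2 - a.2 + (c.2 - b.2) by ring]
        push_cast
        linarith
    intro n hn a b h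
    rw [sub_zero]
    exact (this n a b h).trans (by exact_mod_cast Nat.mul_le_mul_right N hn)
  obtain ⟨z, -, hz, hzw⟩ := hw.lift (E := CochainEdge H X (fun _ _ => 0) F)
      (lo := -(M : ℤ)) (hi := M) (fun a b hab => by
    rcases hab with hab | ⟨μ, hμ, hab⟩
    · exact ⟨0, by simp, by simp, fun c => Or.inr ⟨hab, by simp⟩⟩
    · have hM : |F μ b - F μ a| ≤ M := by
        by_cases hl : μ = l
        · rcases hab hl with h | h
          · subst hl
            have hb : u⁻¹ * b ∉ H μ := fun hb => h (mul_inv_mem_trans hb (inv_mul_mem_symm hμ))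
            simp [F, h, hb]
          · exact (hF μ a b hμ).trans (by exact_mod_cast h)
        · simp [F, hl]
      exact ⟨F μ b - F μ a, (abs_le.1 hM).1, (abs_le.1 hM).2,
        fun c => Or.inl ⟨μ, hμ, by simp⟩⟩)
  have h1 : CochainEdge H X (fun _ _ => 0) F (v, 0 + z) (u, 0 + z + (F l u - F l v)) :=
    Or.inl ⟨l, inv_mul_mem_symm hv, by simp⟩
  have h2 := hC _ F (N * N) (by simp) hD _ _ _ ((hzw 0).step h1) rfl
  have hFu : F l u = 0 := by simp [F, wordDist_self]
  have hFv : F l v = wordDist X u v := by simp [F, hv]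
  simp only [hFu, hFv] at h2
  have h3 := (abs_le.1 h2).1
  push_cast at h3
  have : (wordDist X u v : ℤ) ≤ M * n + N * N * C * (n + 2) := by linarith
  exact_mod_cast this

end Isolated

end RelHyp

namespace RelHyp

section Area

variable {G : Type*} [Group G] {Λ : Type*} {H : Λ → Subgroup G} {X : Set G}

/-- The edges of `Γ(G, X ∪ 𝓗)`. -/
def RelEdge (H : Λ → Subgroup G) (X : Set G) (u v : G) : Prop :=
  (u⁻¹ * v ∈ X ∨ (u⁻¹ * v)⁻¹ ∈ X) ∨ ∃ l, u⁻¹ * v ∈ H l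

theorem RelEdge.symm (u v : G) (h : RelEdge H X u v) : RelEdge H X v u := by
  rcases h with h | ⟨l, h⟩
  · left
    simpa [or_comm] using h
  · exact Or.inr ⟨l, inv_mul_mem_symm h⟩

theorem RelEdge.dist_le_one {u v : G} (h : RelEdge H X u v) :
    wordDist (relGens H X) u v ≤ 1 := by
  rcases h with h | ⟨l, h⟩
  · exact wordDist_le_one (h.imp Or.inl Or.inl)
  · exact relGens_dist_le_one h

theorem exists_relEdge_walk (hX : Subgroup.closure X = ⊤) (u v : G) :
    Walk (RelEdge H X) (wordDist (relGens H X) u v) u v :=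
  (exists_walk (closure_relGens hX) u v).mono fun _ _ h => mem_or_of_relGens h

/-- The signed area swept by an edge, for the weight `f` and the height `x`, is realised by a
relation all of whose closed walks have linearly bounded increment. -/
theorem exists_area_bound (hX : Subgroup.closure X = ⊤) (hXfin : X.Finite)
    (hhyp : IsRelHyperbolic H) :
    ∃ E : ℕ, ∀ f x : G → ℤ, (∀ a b, |f b - f a| ≤ wordDist (relGens H X) a b) →
      (∀ a b, |x b - x a| ≤ wordDist (relGens H X) a b) →
      ∃ T : G × ℤ → G × ℤ → Prop,
        (∀ u v, RelEdge H X u v → ∃ r r', wordDist (relGens H X) u r ≤ 1 ∧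
          wordDist (relGens H X) u r' ≤ 1 ∧
          ∀ c, T (u, c) (v, c + (f r + f r') * (x v - x u))) ∧
        ∀ n a b, Walk T n a b → a.1 = b.1 → |b.2 - a.2| ≤ E * (n + 1) := by
  classical
  obtain ⟨N, C, hC⟩ := exists_cochain_bound hXfin hhyp
  set K : ℕ := (2 + N) * N + 2 * (N * N * N) with hK
  set D : ℕ := N * K + N * N * (N * N) with hD
  refine ⟨D * C, fun f x hf hx => ?_⟩
  let rep : Λ → G → G := fun l g => (g : G ⧸ H l).out
  have hrep : ∀ l g, g⁻¹ * rep l g ∈ H l := fun l g =>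
    QuotientGroup.eq.1 (QuotientGroup.out_eq' (g : G ⧸ H l)).symm
  have hrep' : ∀ l a b, a⁻¹ * b ∈ H l → rep l a = rep l b := fun l a b h => by
    simp only [rep, QuotientGroup.eq.2 h]
  let ψ : G → G → ℤ := fun u v => (f u + f v) * (x v - x u)
  let F : Λ → G → ℤ := fun l g => 2 * f (rep l g) * x g
  have hedge : ∀ (a b : G) (l : Λ), a⁻¹ * b ∈ H l →
      F l b - F l a = (f (rep l a) + f (rep l a)) * (x b - x a) := by
    intro a b l h
    simp only [F, ← hrep' l a b h]
    ring
  have hlip : ∀ {y : G → ℤ}, (∀ a b, |y b - y a| ≤ wordDist (relGens H X) a b) →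
      ∀ {a b : G}, wordDist X a b ≤ N → |y b - y a| ≤ N := fun hy a b h =>
    (hy a b).trans (by exact_mod_cast (relGens_dist_le hX a b).trans h)
  have hstep : ∀ a b, SmallEdge H X N ψ F a b →
      |b.2 - a.2 - 2 * f a.1 * (x b.1 - x a.1)| ≤ ((2 + N) * N : ℕ) := by
    rintro a b ⟨hN, h⟩
    have hxN := hlip hx hN
    have hfN := hlip hf hN
    have : ∃ w, |w| ≤ ((2 + N : ℕ) : ℤ) ∧ b.2 - a.2 = (2 * f a.1 + w) * (x b.1 - x a.1) := by
      rcases h with ⟨l, hl, h⟩ | h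
      · refine ⟨2 * (f (rep l a.1) - f a.1), ?_, ?_⟩
        · have h1 := hf a.1 (rep l a.1)
          have h2 := relGens_dist_le_one (X := X) (hrep l a.1)
          rw [abs_mul, abs_two]
          push_cast
          zify at h2
          linarith
        · rw [h, hedge _ _ l hl]
          ring
      · refine ⟨f b.1 - f a.1, ?_, ?_⟩
        · push_cast
          linarith
        · rw [h]
          simp only [ψ]
          ring
    obtain ⟨w, hw, h⟩ := this
    rw [h, show (2 * f a.1 + w) * (x b.1 - x a.1) - 2 * f a.1 * (x b.1 - x a.1) =
      w * (x b.1 - x a.1) by ring, abs_mul]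
    push_cast at hw ⊢
    exact mul_le_mul hw hxN (abs_nonneg _) (by positivity)
  have hwalk : ∀ n a b, Walk (SmallEdge H X N ψ F) n a b →
      wordDist X a.1 b.1 ≤ n * N ∧
      (n ≤ N → |b.2 - a.2 - 2 * f a.1 * (x b.1 - x a.1)| ≤ (n * K : ℕ)) := by
    intro n a b h
    induction h with
    | refl a => simp [wordDist_self]
    | @step n a b c _ hbc ih =>
      refine ⟨?_, fun hn => ?_⟩
      · have := wordDist_triangle hX a.1 b.1 c.1
        have := hbc.1
        rw [add_mul, one_mul]
        omega
      · have h1 := ih.2 (by omega)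
        have h2 := hstep b c hbc
        have h3 : |f b.1 - f a.1| ≤ ((N * N : ℕ) : ℤ) := (hf a.1 b.1).trans (by
          exact_mod_cast (relGens_dist_le hX _ _).trans
            (ih.1.trans (Nat.mul_le_mul_right N (by omega))))
        have h4 := hlip hx hbc.1
        have h5 : |2 * (f b.1 - f a.1) * (x c.1 - x b.1)| ≤ 2 * ((N * N * N : ℕ) : ℤ) := by
          rw [abs_mul, abs_mul, abs_two, mul_assoc]
          push_cast at h3 ⊢
          have := mul_le_mul h3 h4 (abs_nonneg _) (by positivity)
          linarith
        rw [show c.2 - a.2 - 2 * f a.1 * (x c.1 - x a.1) =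
          (b.2 - a.2 - 2 * f a.1 * (x b.1 - x a.1)) +
          (c.2 - b.2 - 2 * f b.1 * (x c.1 - x b.1)) +
          2 * (f b.1 - f a.1) * (x c.1 - x b.1) by ring]
        refine (abs_add_three _ _ _).trans ?_
        rw [hK] at h1 ⊢
        push_cast at h1 h2 h5 ⊢
        linarith
  have hsmall : ∀ n ≤ N, ∀ a b, Walk (SmallEdge H X N ψ F) n a b →
      |b.2 - a.2 - ψ a.1 b.1| ≤ D := by
    intro n hn a b h
    obtain ⟨h1, h2⟩ := hwalk n a b h
    have h2 := h2 hn
    have h3 : ((wordDist (relGens H X) a.1 b.1 : ℕ) : ℤ) ≤ (N * N : ℕ) := by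
      exact_mod_cast (relGens_dist_le hX _ _).trans (h1.trans (Nat.mul_le_mul_right N hn))
    have h4 : |(f b.1 - f a.1) * (x b.1 - x a.1)| ≤ ((N * N : ℕ) : ℤ) * (N * N : ℕ) := by
      rw [abs_mul]
      exact mul_le_mul ((hf _ _).trans h3) ((hx _ _).trans h3) (abs_nonneg _) (by positivity)
    have h5 : ((n * K : ℕ) : ℤ) ≤ (N * K : ℕ) := by exact_mod_cast Nat.mul_le_mul_right K hn
    rw [show b.2 - a.2 - ψ a.1 b.1 = (b.2 - a.2 - 2 * f a.1 * (x b.1 - x a.1)) -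
      (f b.1 - f a.1) * (x b.1 - x a.1) by simp only [ψ]; ring]
    refine (abs_sub _ _).trans ?_
    rw [hD]
    push_cast at h2 h4 h5 ⊢
    linarith
  refine ⟨CochainEdge H X ψ F, ?_, fun n a b h hab => ?_⟩
  · rintro u v (h | ⟨l, h⟩)
    · exact ⟨u, v, by simp [wordDist_self], RelEdge.dist_le_one (Or.inl h),
        fun c => Or.inr ⟨h, by simp [ψ]⟩⟩
    · exact ⟨rep l u, rep l u, relGens_dist_le_one (hrep l u), relGens_dist_le_one (hrep l u),
        fun c => Or.inl ⟨l, h, by simp [hedge u v l h]⟩⟩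
  · have := hC ψ F D (fun u v => by simp only [ψ]; ring) hsmall n a b h hab
    push_cast at this ⊢
    exact this

end Area

end RelHyp

namespace RelHyp

section Geod

variable {G : Type*} [Group G] {Λ : Type*} {H : Λ → Subgroup G} {X : Set G}

/-- `P` restricted to `{0, …, n}` is the vertex sequence of a geodesic of `Γ(G, X ∪ 𝓗)`, where
`lab i` is the index of the parabolic subgroup carrying the `i`-th edge, if any. -/
structure IsGeod (H : Λ → Subgroup G) (X : Set G) (n : ℕ) (P : ℕ → G) (lab : ℕ → Option Λ) :
    Prop where
  h_edge : ∀ i < n, ∀ l, lab i = some l → (P i)⁻¹ * P (i + 1) ∈ H l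
  x_edge : ∀ i < n, lab i = none →
    (P i)⁻¹ * P (i + 1) ∈ X ∨ ((P i)⁻¹ * P (i + 1))⁻¹ ∈ X
  dist_eq : ∀ i j, i ≤ j → j ≤ n → wordDist (relGens H X) (P i) (P j) = j - i

variable {n : ℕ} {P Q : ℕ → G} {lab lab' : ℕ → Option Λ}

theorem IsGeod.mul_left (hP : IsGeod H X n P lab) (s : G) :
    IsGeod H X n (fun i => s * P i) lab where
  h_edge i hi l hl := by simpa [mul_assoc] using hP.h_edge i hi l hl
  x_edge i hi hl := by simpa [mul_assoc] using hP.x_edge i hi hl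
  dist_eq i j hij hj := by rw [wordDist_mul_left, hP.dist_eq i j hij hj]

theorem IsGeod.relEdge (hP : IsGeod H X n P lab) {i : ℕ} (hi : i < n) :
    RelEdge H X (P i) (P (i + 1)) := by
  rcases hl : lab i with _ | l
  · exact Or.inl (hP.x_edge i hi hl)
  · exact Or.inr ⟨l, hP.h_edge i hi l hl⟩

theorem exists_isGeod (hX : Subgroup.closure X = ⊤) (u v : G) :
    ∃ P lab, P 0 = u ∧ P (wordDist (relGens H X) u v) = v ∧
      IsGeod H X (wordDist (relGens H X) u v) P lab := by
  classical
  have hS := closure_relGens (H := H) hX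
  obtain ⟨P, h0, h1, hP⟩ := exists_seq hS u v
  set n := wordDist (relGens H X) u v with hn
  have hle : ∀ i j, i ≤ j → j ≤ n → wordDist (relGens H X) (P i) (P j) ≤ j - i := by
    intro i j hij
    induction j, hij using Nat.le_induction with
    | base => simp [wordDist_self]
    | succ j hij ih =>
      intro hj
      have := ih (by omega)
      have := wordDist_le_one (hP j (by omega))
      have := wordDist_triangle hS (P i) (P j) (P (j + 1))
      omega
  refine ⟨P, fun i => if h : ∃ l, (P i)⁻¹ * P (i + 1) ∈ H l then some h.choose else none,
    h0, h1, ?_, ?_, ?_⟩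
  · intro i _ l hl
    split_ifs at hl with h
    cases hl
    exact h.choose_spec
  · intro i hi hl
    split_ifs at hl with h
    exact (mem_or_of_relGens (hP i hi)).resolve_right h
  · intro i j hij hj
    have h2 := hle 0 i (by omega) (by omega)
    have h3 := hle j n hj le_rfl
    have h4 := hle i j hij hj
    have h5 := wordDist_triangle hS (P 0) (P i) (P n)
    have h6 := wordDist_triangle hS (P i) (P j) (P n)
    rw [h0, h1, ← hn] at h5
    rw [h0] at h2
    rw [h1] at h3 h6
    omega

/-- Two geodesics with close endpoints stay close at synchronous vertices. -/
theorem exists_fellow_travel (hX : Subgroup.closure X = ⊤) (hXfin : X.Finite)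
    (hhyp : IsRelHyperbolic H) (k : ℕ) :
    ∃ K, k ≤ K ∧ ∀ (n : ℕ) (P Q : ℕ → G) (lab lab' : ℕ → Option Λ),
      IsGeod H X n P lab → IsGeod H X n Q lab' →
      wordDist (relGens H X) (P 0) (Q 0) ≤ k → wordDist (relGens H X) (P n) (Q n) ≤ k →
      ∀ i ≤ n, wordDist (relGens H X) (P i) (Q i) ≤ K := by
  classical
  have hS := closure_relGens (H := H) hX
  obtain ⟨E, hE⟩ := exists_area_bound hX hXfin hhyp
  set D : ℕ := k + E + 2 with hD
  set L : ℕ := 4 * D * D + 6 * D + E * (4 * D + 1) with hL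
  refine ⟨2 * (L + D) + k, by omega, fun n P Q lab lab' hP hQ h0 hn => ?_⟩
  -- distance to the geodesic `P`
  obtain ⟨d, hd, hd'⟩ : ∃ d : G → ℕ, (∀ g, ∃ j ≤ n, wordDist (relGens H X) g (P j) = d g) ∧
      ∀ g, ∀ j ≤ n, d g ≤ wordDist (relGens H X) g (P j) :=
    ⟨fun g => sInf {m | ∃ j ≤ n, wordDist (relGens H X) g (P j) = m},
      fun g => Nat.sInf_mem (s := {m | ∃ j ≤ n, wordDist (relGens H X) g (P j) = m})
        ⟨_, 0, Nat.zero_le _, rfl⟩,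
      fun g j hj => Nat.sInf_le ⟨j, hj, rfl⟩⟩
  have hlip : ∀ a b, d a ≤ wordDist (relGens H X) a b + d b := by
    intro a b
    obtain ⟨j, hj, h⟩ := hd b
    have := hd' a j hj
    have := wordDist_triangle hS a b (P j)
    omega
  have hlip' : ∀ a b, d b ≤ wordDist (relGens H X) a b + d a := fun a b => by
    rw [wordDist_comm hS]; exact hlip b a
  let f : G → ℤ := fun g => max 0 ((D : ℤ) - d g)
  let x : G → ℤ := fun g => wordDist (relGens H X) (P 0) g
  have hf0 : ∀ g, 0 ≤ f g := fun g => le_max_left _ _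
  have hfD : ∀ g, f g ≤ D := fun g => max_le (by positivity) (by linarith [(d g).zero_le])
  have hfge : ∀ g, (D : ℤ) - d g ≤ f g := fun g => le_max_right _ _
  have hfz : ∀ g, D ≤ d g → f g = 0 := fun g h => max_eq_left (by zify at h; linarith)
  have hf : ∀ a b, |f b - f a| ≤ wordDist (relGens H X) a b := by
    intro a b
    have h1 := hlip a b
    have h2 := hlip' a b
    zify at h1 h2
    have h3 := hfge a
    have h4 := hfge b
    have h5 : f b ≤ f a + wordDist (relGens H X) a b :=
      max_le (by linarith [hf0 a]) (by linarith)
    have h6 : f a ≤ f b + wordDist (relGens H X) a b :=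
      max_le (by linarith [hf0 b]) (by linarith)
    rw [abs_le]
    constructor <;> linarith
  have hx : ∀ a b, |x b - x a| ≤ wordDist (relGens H X) a b := by
    intro a b
    have h1 := wordDist_triangle hS (P 0) a b
    have h2 := wordDist_triangle hS (P 0) b a
    rw [wordDist_comm hS b a] at h2
    zify at h1 h2
    simp only [x]
    rw [abs_le]
    constructor <;> linarith
  obtain ⟨T, hT, hTE⟩ := hE f x hf hx
  -- lifting of arbitrary edges
  have hlift1 : ∀ u v, RelEdge H X u v →
      ∃ y : ℤ, -(2 * D : ℤ) ≤ y ∧ y ≤ 2 * D ∧ ∀ c, T (u, c) (v, c + y) := by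
    intro u v huv
    obtain ⟨r, r', _, _, h⟩ := hT u v huv
    have h1 : |(f r + f r') * (x v - x u)| ≤ 2 * D := by
      have h2 : |x v - x u| ≤ 1 := (hx u v).trans (by exact_mod_cast huv.dist_le_one)
      have h3 : |f r + f r'| ≤ 2 * D := by
        rw [abs_of_nonneg (add_nonneg (hf0 r) (hf0 r'))]
        linarith [hfD r, hfD r']
      rw [abs_mul]
      calc |f r + f r'| * |x v - x u| ≤ 2 * D * 1 :=
            mul_le_mul h3 h2 (abs_nonneg _) (by positivity)
        _ = 2 * D := by ring
    exact ⟨_, (abs_le.1 h1).1, (abs_le.1 h1).2, h⟩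
  let r0 : G → G → Prop := fun u v => RelEdge H X u v ∧ D + 1 ≤ d u ∧ D + 1 ≤ d v
  have hr0 : ∀ u v, r0 u v → r0 v u := fun u v h => ⟨h.1.symm, h.2.2, h.2.1⟩
  have hlift0 : ∀ u v, r0 u v → ∃ y : ℤ, 0 ≤ y ∧ y ≤ 0 ∧ ∀ c, T (u, c) (v, c + y) := by
    rintro u v ⟨huv, hu, -⟩
    obtain ⟨r, r', h1, h2, h⟩ := hT u v huv
    have h3 := hlip u r
    have h4 := hlip u r'
    refine ⟨_, ?_, ?_, h⟩ <;> rw [hfz r (by omega), hfz r' (by omega)] <;> simp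
  -- the far part contributes a controlled amount
  have hrest : ∀ p0 p1 p2 A B B' A', Walk (RelEdge H X) p1 A B → Walk r0 p0 B B' →
      Walk (RelEdge H X) p2 B' A' →
      ∃ z : ℤ, |z| ≤ 2 * D * (p1 + p2) ∧ ∀ c, Walk T (p1 + p0 + p2) (A, c) (A', c + z) := by
    intro p0 p1 p2 A B B' A' w1 w0 w2
    obtain ⟨z1, h1, h1', w1⟩ := w1.lift hlift1
    obtain ⟨z0, h0, h0', w0⟩ := w0.lift hlift0
    obtain ⟨z2, h2, h2', w2⟩ := w2.lift hlift1
    refine ⟨z1 + z0 + z2, ?_, fun c => ?_⟩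
    · rw [abs_le]
      constructor <;> linarith
    · have := ((w1 c).trans (w0 _)).trans (w2 _)
      simpa only [add_assoc] using this
  have hdP : ∀ i ≤ n, d (P i) = 0 := fun i hi => by
    have := hd' (P i) i hi
    rw [wordDist_self] at this
    omega
  -- the near part contributes a large amount
  have hnear : ∀ a b, a ≤ b → b ≤ n → ∃ z : ℤ, (2 * D - 2) * ((b - a : ℕ) : ℤ) ≤ z ∧
      ∀ c, Walk T (b - a) (P a, c) (P b, c + z) := by
    intro a b hab hb
    have hw : Walk (fun u v => ∃ i < n, u = P i ∧ v = P (i + 1)) (b - a) (P a) (P b) :=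
      Walk.of_seq P hab fun i _ hi => ⟨i, by omega, rfl, rfl⟩
    obtain ⟨z, hz, -, hz'⟩ := hw.lift (E := T) (lo := 2 * D - 2) (hi := 2 * D) (by
      rintro _ _ ⟨i, hi, rfl, rfl⟩
      obtain ⟨r, r', h1, h2, h⟩ := hT _ _ (hP.relEdge hi)
      have hxi : x (P (i + 1)) - x (P i) = 1 := by
        simp only [x]
        rw [hP.dist_eq 0 _ (by omega) (by omega), hP.dist_eq 0 _ (by omega) (by omega)]
        simp
      have h3 := hlip' (P i) r
      have h4 := hlip' (P i) r'
      rw [hdP i hi.le] at h3 h4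
      rw [hxi] at h
      refine ⟨_, ?_, ?_, h⟩
      · have := hfge r
        have := hfge r'
        zify at h1 h2 h3 h4
        linarith
      · linarith [hfD r, hfD r'])
    exact ⟨z, hz, hz'⟩
  -- a closed polygon cannot have long near part
  have hpoly : ∀ p0 p1 p2 a b B B', a ≤ b → b ≤ n → Walk (RelEdge H X) p1 (P b) B →
      Walk r0 p0 B B' → Walk (RelEdge H X) p2 B' (P a) →
      (2 * D - 2 : ℤ) * ((b - a : ℕ) : ℤ) ≤
        2 * D * (p1 + p2) + E * (((b - a : ℕ) : ℤ) + p1 + p0 + p2 + 1) := by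
    intro p0 p1 p2 a b B B' hab hb w1 w0 w2
    obtain ⟨z, hz, hw⟩ := hnear a b hab hb
    obtain ⟨z', hz', hw'⟩ := hrest _ _ _ _ _ _ _ w1 w0 w2
    have h1 := hTE _ _ _ ((hw 0).trans (hw' _)) rfl
    have h2 := (abs_le.1 h1).2
    have h3 := (abs_le.1 hz').1
    push_cast at h2
    rw [Nat.cast_sub hab] at h2 hz ⊢
    simp only [zero_add, sub_zero] at h2
    linarith
  -- every vertex of `Q` is close to `P`
  have hclose : ∀ i ≤ n, d (Q i) ≤ L + D := by
    intro i hi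
    by_contra! hfar
    have hQ0 : d (Q 0) ≤ D := (hd' _ 0 (Nat.zero_le _)).trans (by
      rw [wordDist_comm hS]; omega)
    have hQn : d (Q n) ≤ D := (hd' _ n le_rfl).trans (by
      rw [wordDist_comm hS]; omega)
    obtain ⟨s, hsi, hs, hs'⟩ : ∃ s ≤ i, d (Q s) ≤ D ∧ ∀ j, s < j → j ≤ i → D < d (Q j) := by
      refine ⟨Nat.findGreatest (fun j => d (Q j) ≤ D) i, Nat.findGreatest_le _,
        Nat.findGreatest_spec (P := fun j => d (Q j) ≤ D) (Nat.zero_le i) hQ0,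
        fun j h1 h2 => not_le.1
          (Nat.findGreatest_is_greatest (P := fun j => d (Q j) ≤ D) h1 h2)⟩
    obtain ⟨t, hit, htn, ht, ht'⟩ : ∃ t, i ≤ t ∧ t ≤ n ∧ d (Q t) ≤ D ∧
        ∀ j, i ≤ j → j < t → D < d (Q j) := by
      have hex : ∃ j, i ≤ j ∧ d (Q j) ≤ D := ⟨n, hi, hQn⟩
      refine ⟨Nat.find hex, (Nat.find_spec hex).1, Nat.find_min' hex ⟨hi, hQn⟩,
        (Nat.find_spec hex).2, fun j h1 h2 => ?_⟩
      by_contra! h3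
      exact Nat.find_min hex h2 ⟨h1, h3⟩
    have hsi' : s ≠ i := by rintro rfl; omega
    have hti' : i ≠ t := by rintro rfl; omega
    obtain ⟨a, ha, hda⟩ := hd (Q s)
    obtain ⟨b, hb, hdb⟩ := hd (Q t)
    have hst := hQ.dist_eq s t (by omega) htn
    have hsi2 := hQ.dist_eq s i hsi hi
    -- the three pieces
    have w1 := ((exists_relEdge_walk (H := H) hX (Q s) (P a)).symm RelEdge.symm).trans
      (Walk.single (hQ.relEdge (i := s) (by omega)))
    have w0 : Walk r0 (t - 1 - (s + 1)) (Q (s + 1)) (Q (t - 1)) := by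
      refine Walk.of_seq Q (by omega) fun j h1 h2 => ⟨hQ.relEdge (by omega), ?_, ?_⟩
      · rcases le_total j i with h | h
        · exact hs' j (by omega) h
        · exact ht' j h (by omega)
      · rcases le_total (j + 1) i with h | h
        · exact hs' _ (by omega) h
        · exact ht' _ h (by omega)
    have hlast := hQ.relEdge (i := t - 1) (by omega)
    rw [show t - 1 + 1 = t by omega] at hlast
    have w2 := (Walk.single hlast).trans (exists_relEdge_walk (H := H) hX (Q t) (P b))
    rw [hda] at w1
    rw [hdb] at w2
    have htri : t - s ≤ d (Q s) + wordDist (relGens H X) (P a) (P b) + d (Q t) := by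
      have h1 := wordDist_triangle hS (Q s) (P a) (Q t)
      have h2 := wordDist_triangle hS (P a) (P b) (Q t)
      rw [wordDist_comm hS (P b) (Q t)] at h2
      omega
    -- conclude from an estimate of the gap on `P`
    have key : ∀ δ : ℕ, t - s ≤ δ + 2 * D →
        (2 * D - 2 : ℤ) * δ ≤ 2 * D * (2 * D + 2) + E * (δ + (t - s : ℕ) + 2 * D + 1) →
        False := by
      intro δ h1 h2
      have h3 : t - s ≤ L := by
        have h4 : ((t - s : ℕ) : ℤ) ≤ δ + 2 * D := by exact_mod_cast h1
        have h5 : (E : ℤ) * (δ + (t - s : ℕ) + 2 * D + 1) ≤ E * (2 * δ + 4 * D + 1) :=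
          mul_le_mul_of_nonneg_left (by linarith) (by positivity)
        have h6 : (δ : ℤ) ≤ 2 * D * (2 * D + 2) + E * (4 * D + 1) := by
          have h7 : (2 * E + 1 : ℤ) * δ ≤ (2 * D - 2) * δ :=
            mul_le_mul_of_nonneg_right (by rw [hD]; push_cast; linarith [k.zero_le])
              (by positivity)
          linarith
        have h8 : ((t - s : ℕ) : ℤ) ≤ L := by
          rw [hL]
          push_cast
          linarith
        exact_mod_cast h8
      have h9 := hlip (Q i) (Q s)
      rw [wordDist_comm hS] at h9
      omega
    have hD' : (d (Q s) : ℤ) ≤ D ∧ (d (Q t) : ℤ) ≤ D := ⟨by exact_mod_cast hs, by exact_mod_cast ht⟩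
    have hts : ((t - 1 - (s + 1) : ℕ) : ℤ) = ((t - s : ℕ) : ℤ) - 2 := by omega
    have hDD : (2 * D : ℤ) * (d (Q s) + 1 + (1 + d (Q t))) ≤ 2 * D * (2 * D + 2) :=
      mul_le_mul_of_nonneg_left (by linarith [hD'.1, hD'.2]) (by positivity)
    have hEE : ∀ δ : ℕ, (E : ℤ) * (δ + (d (Q s) + 1) + ((t - 1 - (s + 1) : ℕ) : ℤ) +
        (1 + d (Q t)) + 1) ≤ E * (δ + (t - s : ℕ) + 2 * D + 1) := fun δ =>
      mul_le_mul_of_nonneg_left (by rw [hts]; linarith [hD'.1, hD'.2]) (by positivity)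
    rcases le_total a b with hab | hab
    · have h1 := hpoly _ _ _ a b _ _ hab hb (w2.symm RelEdge.symm) (w0.symm hr0)
        (w1.symm RelEdge.symm)
      rw [hP.dist_eq a b hab hb] at htri
      refine key (b - a) (by omega) ?_
      have := hEE (b - a)
      push_cast at h1 this ⊢
      linarith
    · have h1 := hpoly _ _ _ b a _ _ hab ha w1 w0 w2
      rw [wordDist_comm hS, hP.dist_eq b a hab ha] at htri
      refine key (a - b) (by omega) ?_
      have := hEE (a - b)
      push_cast at h1 this ⊢
      linarith
  intro i hi
  obtain ⟨j, hj, hdj⟩ := hd (Q i)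
  have h1 := hclose i hi
  have h2 := wordDist_triangle hS (P 0) (Q 0) (Q i)
  have h3 := wordDist_triangle hS (P 0) (Q i) (P j)
  have h4 := wordDist_triangle hS (Q 0) (P 0) (Q i)
  have h5 := wordDist_triangle hS (P 0) (P j) (Q i)
  rw [wordDist_comm hS (Q 0) (P 0)] at h4
  rw [wordDist_comm hS (P j) (Q i)] at h5
  rw [hP.dist_eq 0 j (Nat.zero_le _) hj] at h3 h5
  rw [hQ.dist_eq 0 i (Nat.zero_le _) hi] at h2 h4
  have h6 := wordDist_triangle hS (P i) (P j) (Q i)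
  rw [wordDist_comm hS (P j) (Q i)] at h6
  rcases le_total i j with hij | hij
  · rw [hP.dist_eq i j hij hj] at h6
    omega
  · rw [wordDist_comm hS (P i) (P j), hP.dist_eq j i hij hi] at h6
    omega

end Geod

end RelHyp

namespace RelHyp

section Pair

variable {G : Type*} [Group G] {Λ : Type*} {H : Λ → Subgroup G} {X : Set G}
variable {n : ℕ} {P Q : ℕ → G} {lab : ℕ → Option Λ}

theorem IsGeod.walk_avoid (hP : IsGeod H X n P lab) {l : Λ} {x : G} {M a b : ℕ} (hab : a ≤ b)
    (hb : b ≤ n) (h : ∀ i, a ≤ i → i < b → lab i = some l → x⁻¹ * P i ∈ H l →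
      wordDist X (P i) (P (i + 1)) ≤ M) :
    Walk (AvoidEdge H X l x M) (b - a) (P a) (P b) := by
  refine Walk.of_seq P hab fun i h1 h2 => ?_
  rcases hl : lab i with _ | μ
  · exact Or.inl (hP.x_edge i (by omega) hl)
  · refine Or.inr ⟨μ, hP.h_edge i (by omega) μ hl, ?_⟩
    rintro rfl
    by_cases hx : x⁻¹ * P i ∈ H μ
    · exact Or.inr (h i h1 h2 hl hx)
    · exact Or.inl hx

theorem IsGeod.not_mem_of_lt (hP : IsGeod H X n P lab) {l : Λ} {i j : ℕ} (hij : i < j)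
    (hj : j < n) (hl : lab j = some l) : (P i)⁻¹ * P j ∉ H l := by
  intro h
  have h1 := relGens_dist_le_one (X := X) (mul_inv_mem_trans h (hP.h_edge j hj l hl))
  rw [hP.dist_eq i (j + 1) (by omega) (by omega)] at h1
  omega

theorem IsGeod.eq_of_mem (hP : IsGeod H X n P lab) {l : Λ} {i j : ℕ} (hi : i < n) (hj : j < n)
    (hli : lab i = some l) (hlj : lab j = some l) {x : G} (hxi : x⁻¹ * P i ∈ H l)
    (hxj : x⁻¹ * P j ∈ H l) : i = j := by
  have h := mul_inv_mem_trans (inv_mul_mem_symm hxi) hxj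
  rcases lt_trichotomy i j with hij | hij | hij
  · exact absurd h (hP.not_mem_of_lt hij hj hlj)
  · exact hij
  · exact absurd (inv_mul_mem_symm h) (hP.not_mem_of_lt hij hi hli)

/-- The walk along a geodesic to the left of an edge avoids the coset of this edge. -/
theorem IsGeod.walk_left (hP : IsGeod H X n P lab) {l : Λ} {x : G} {M a b : ℕ} (hab : a ≤ b)
    (hb : b < n) (hl : lab b = some l) (hx : x⁻¹ * P b ∈ H l) :
    Walk (AvoidEdge H X l x M) (b - a) (P a) (P b) :=
  hP.walk_avoid hab hb.le fun i _ h2 h3 h4 =>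
    absurd (hP.eq_of_mem (by omega) hb h3 hl h4 hx) (by omega)

/-- The walk along a geodesic to the right of an edge avoids the coset of this edge. -/
theorem IsGeod.walk_right (hP : IsGeod H X n P lab) {l : Λ} {x : G} {M a b : ℕ} (hab : a < b)
    (hb : b ≤ n) (hl : lab a = some l) (hx : x⁻¹ * P a ∈ H l) :
    Walk (AvoidEdge H X l x M) (b - (a + 1)) (P (a + 1)) (P b) :=
  hP.walk_avoid hab hb fun i h1 h2 h3 h4 =>
    absurd (hP.eq_of_mem (by omega) (by omega) h3 hl h4 hx) (by omega)

/-- `C` is a constant as in `exists_isolated_bound`. -/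
def IsIsolatedBound (H : Λ → Subgroup G) (X : Set G) (C : ℕ) : Prop :=
  ∀ (l : Λ) (x : G) (M n : ℕ) (u v : G), Walk (AvoidEdge H X l x M) n u v →
    x⁻¹ * u ∈ H l → x⁻¹ * v ∈ H l → wordDist X u v ≤ M * n + C * (n + 2)

theorem IsIsolatedBound.dist_le {C : ℕ} (hC : IsIsolatedBound H X C) {l : Λ} {x : G} {n N : ℕ}
    {u v : G} (hw : Walk (AvoidEdge H X l x 0) n u v) (hu : x⁻¹ * u ∈ H l)
    (hv : x⁻¹ * v ∈ H l) (hn : n + 2 ≤ N) : wordDist X u v ≤ C * N := by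
  have := hC l x 0 n u v hw hu hv
  rw [zero_mul, zero_add] at this
  exact this.trans (Nat.mul_le_mul_left C hn)

/-- Two geodesics with the same label, close relative to `X ∪ 𝓗`, with `X`-close endpoints. -/
structure IsPair (H : Λ → Subgroup G) (X : Set G) (K n : ℕ) (P Q : ℕ → G)
    (lab : ℕ → Option Λ) : Prop where
  left : IsGeod H X n P lab
  right : IsGeod H X n Q lab
  near : ∀ i ≤ n, wordDist (relGens H X) (P i) (Q i) ≤ K
  start : wordDist X (P 0) (Q 0) ≤ K
  finish : wordDist X (P n) (Q n) ≤ K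

variable {K : ℕ}

theorem IsPair.symm (hX : Subgroup.closure X = ⊤) (h : IsPair H X K n P Q lab) :
    IsPair H X K n Q P lab where
  left := h.right
  right := h.left
  near i hi := wordDist_comm (closure_relGens hX) (P i) (Q i) ▸ h.near i hi
  start := wordDist_comm hX (P 0) (Q 0) ▸ h.start
  finish := wordDist_comm hX (P n) (Q n) ▸ h.finish

theorem IsPair.exists_anchor (hX : Subgroup.closure X = ⊤) (h : IsPair H X K n P Q lab) {i : ℕ}
    (hi : i ≤ n) {x : G} (hx : i = 0 ∨ i = n ∨ K + 1 < wordDist (relGens H X) x (P i))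
    (l : Λ) (M : ℕ) : ∃ r ≤ K, Walk (AvoidEdge H X l x M) r (P i) (Q i) := by
  rcases hx with rfl | rfl | hx
  · exact ⟨_, h.start, (exists_walk hX _ _).mono fun _ _ => Or.inl⟩
  · exact ⟨_, h.finish, (exists_walk hX _ _).mono fun _ _ => Or.inl⟩
  · obtain ⟨c, lab', h0, h1, hc⟩ := exists_isGeod (H := H) hX (P i) (Q i)
    have hn := h.near i hi
    refine ⟨_, hn, ?_⟩
    have := hc.walk_avoid (l := l) (x := x) (M := M) (Nat.zero_le _) le_rfl
      fun s _ hs _ hxs => by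
        have h2 := relGens_dist_le_one (X := X) hxs
        have h3 := hc.dist_eq 0 s (Nat.zero_le _) hs.le
        have hS := closure_relGens (H := H) hX
        have h4 := wordDist_triangle hS x (c s) (P i)
        rw [h0] at h3
        rw [wordDist_comm hS (c s)] at h4
        omega
    rwa [h0, h1, Nat.sub_zero] at this

theorem IsPair.exists_anchor_left (hX : Subgroup.closure X = ⊤) (h : IsPair H X K n P Q lab)
    {j : ℕ} (hj : j ≤ n) (l : Λ) (M : ℕ) :
    ∃ r ≤ K, Walk (AvoidEdge H X l (P j) M) r (P (j - (2 * K + 3))) (Q (j - (2 * K + 3))) := by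
  refine h.exists_anchor hX (by omega) ?_ l M
  rw [wordDist_comm (closure_relGens hX), h.left.dist_eq _ _ (by omega) hj]
  omega

theorem IsPair.exists_anchor_right (hX : Subgroup.closure X = ⊤) (h : IsPair H X K n P Q lab)
    {j : ℕ} (hj : j ≤ n) (l : Λ) (M : ℕ) :
    ∃ r ≤ K, Walk (AvoidEdge H X l (P j) M) r (P (min (j + (2 * K + 3)) n))
      (Q (min (j + (2 * K + 3)) n)) := by
  refine h.exists_anchor hX (by omega) ?_ l M
  rw [h.left.dist_eq _ _ (by omega) (by omega)]
  omega

theorem IsPair.index_le (hX : Subgroup.closure X = ⊤) (h : IsPair H X K n P Q lab) {l : Λ}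
    {i j : ℕ} (hi : i ≤ n) (hj : j ≤ n) (hij : (P i)⁻¹ * Q j ∈ H l) :
    i ≤ j + (K + 1) ∧ j ≤ i + (K + 1) := by
  have hS := closure_relGens (H := H) hX
  have h1 := relGens_dist_le_one (X := X) hij
  have h2 := h.near i hi
  have h3 := wordDist_triangle hS (Q i) (P i) (Q j)
  rw [wordDist_comm hS (Q i) (P i)] at h3
  rcases le_total i j with hle | hle
  · rw [h.right.dist_eq i j hle hj] at h3
    omega
  · rw [wordDist_comm hS (Q i) (Q j), h.right.dist_eq j i hle hi] at h3
    omega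

variable {C : ℕ} {l : Λ}

/-- A long edge is connected to some edge of the other geodesic. -/
theorem IsPair.exists_connected (hX : Subgroup.closure X = ⊤) (hC : IsIsolatedBound H X C)
    (h : IsPair H X K n P Q lab) {j : ℕ} (hj : j < n) (hl : lab j = some l)
    (hlong : C * (10 * K + 16) < wordDist X (P j) (P (j + 1))) :
    ∃ j' < n, lab j' = some l ∧ (P j)⁻¹ * Q j' ∈ H l := by
  by_contra! hcon
  obtain ⟨r, hr, w⟩ := h.exists_anchor_left hX hj.le l 0
  obtain ⟨r', hr', w'⟩ := h.exists_anchor_right hX hj.le l 0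
  have hself : (P j)⁻¹ * P j ∈ H l := by simp
  have w1 := (h.left.walk_left (M := 0) (a := j - (2 * K + 3)) (by omega) hj hl hself).symm
    (AvoidEdge.symm hX)
  have w2 := (h.left.walk_right (M := 0) (b := min (j + (2 * K + 3)) n) (by omega) (by omega)
    hl hself).symm (AvoidEdge.symm hX)
  have w3 := h.right.walk_avoid (l := l) (x := P j) (M := 0) (a := j - (2 * K + 3))
    (b := min (j + (2 * K + 3)) n) (by omega) (by omega)
    fun i _ h2 h3 h4 => absurd h4 (hcon i (by omega) h3)
  have := hC.dist_le (N := 10 * K + 16)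
    ((((w1.trans w).trans w3).trans (w'.symm (AvoidEdge.symm hX))).trans w2) hself
    (h.left.h_edge j hj l hl) (by omega)
  omega

/-- The endpoints of connected edges are close. -/
theorem IsPair.dist_le_of_connected (hX : Subgroup.closure X = ⊤) (hC : IsIsolatedBound H X C)
    (h : IsPair H X K n P Q lab) {j j' : ℕ} (hj : j < n) (hj' : j' < n) (hl : lab j = some l)
    (hl' : lab j' = some l) (hjj : (P j)⁻¹ * Q j' ∈ H l) :
    wordDist X (P j) (Q j') ≤ C * (10 * K + 16) ∧
      wordDist X (P (j + 1)) (Q (j' + 1)) ≤ C * (10 * K + 16) := by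
  obtain ⟨h1, h2⟩ := h.index_le hX hj.le hj'.le hjj
  have hself : (P j)⁻¹ * P j ∈ H l := by simp
  constructor
  · obtain ⟨r, hr, w⟩ := h.exists_anchor_left hX hj.le l 0
    have w1 := (h.left.walk_left (M := 0) (a := j - (2 * K + 3)) (by omega) hj hl hself).symm
      (AvoidEdge.symm hX)
    have w2 := h.right.walk_left (M := 0) (a := j - (2 * K + 3)) (by omega) hj' hl' hjj
    exact hC.dist_le ((w1.trans w).trans w2) hself hjj (by omega)
  · obtain ⟨r, hr, w⟩ := h.exists_anchor_right hX hj.le l 0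
    have w1 := h.left.walk_right (M := 0) (b := min (j + (2 * K + 3)) n) (by omega) (by omega)
      hl hself
    have w2 := (h.right.walk_right (M := 0) (b := min (j + (2 * K + 3)) n) (by omega) (by omega)
      hl' hjj).symm (AvoidEdge.symm hX)
    exact hC.dist_le ((w1.trans w).trans w2) (h.left.h_edge j hj l hl)
      (mul_inv_mem_trans hjj (h.right.h_edge j' hj' l hl')) (by omega)

/-- Connection of long edges preserves the order. -/
theorem IsPair.lt_of_connected (hX : Subgroup.closure X = ⊤) (hC : IsIsolatedBound H X C)
    (h : IsPair H X K n P Q lab) {j k k' : ℕ} (hjk : j < k) (hk : k < n) (hk' : k' < n)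
    (hlj : lab j = some l) (hlk : lab k = some l)
    (hlong : C * (10 * K + 16) < wordDist X (P j) (P (j + 1)))
    (hc : (P j)⁻¹ * Q k ∈ H l) (hc' : (P k)⁻¹ * Q k' ∈ H l) : k < k' := by
  obtain ⟨h1, h2⟩ := h.index_le hX (by omega) hk.le hc
  obtain ⟨h3, h4⟩ := h.index_le hX hk.le hk'.le hc'
  have hjn : j < n := by omega
  have hself : (P j)⁻¹ * P j ∈ H l := by simp
  have hne : (P j)⁻¹ * Q k' ∉ H l := fun h' => h.left.not_mem_of_lt hjk hk hlk
    (mul_inv_mem_trans h' (inv_mul_mem_symm hc'))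
  by_contra! hle
  obtain ⟨r, hr, w⟩ := h.exists_anchor_left hX hjn.le l 0
  have w1 := (h.left.walk_left (M := 0) (a := j - (2 * K + 3)) (by omega) hjn hlj hself).symm
    (AvoidEdge.symm hX)
  have w2 := h.right.walk_avoid (l := l) (x := P j) (M := 0) (a := j - (2 * K + 3)) (b := k')
    (by omega) hk'.le fun i _ hi hli hxi => absurd
      (h.right.eq_of_mem (by omega) hk hli hlk hxi hc) (by omega)
  have w3 : Walk (AvoidEdge H X l (P j) 0) 1 (Q k') (P k) :=
    Walk.single (Or.inr ⟨l, inv_mul_mem_symm hc', fun _ => Or.inl hne⟩)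
  have w4 := (h.left.walk_right (M := 0) hjk hk.le hlj hself).symm (AvoidEdge.symm hX)
  have := hC.dist_le (N := 10 * K + 16) ((((w1.trans w).trans w2).trans w3).trans w4) hself
    (h.left.h_edge j hjn l hlj) (by omega)
  omega

/-- For three pairs of connected edges, the endpoints of the middle ones are close. -/
theorem dist_le_of_connected_triple (hX : Subgroup.closure X = ⊤) (hC : IsIsolatedBound H X C)
    (hP : IsGeod H X n P lab) (hQ : IsGeod H X n Q lab) {a b c a' b' c' : ℕ}
    (hab : a < b) (hbc : b < c) (hc : c < n) (hab' : a' < b') (hbc' : b' < c') (hc' : c' < n)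
    (ga : b ≤ a + (K + 1)) (gb : c ≤ b + (K + 1)) (ga' : b' ≤ a' + (K + 1))
    (gb' : c' ≤ b' + (K + 1)) (lb : lab b = some l) (lc : lab c = some l)
    (lb' : lab b' = some l) (ca : (P a)⁻¹ * Q a' ∈ H l) (cb : (P b)⁻¹ * Q b' ∈ H l)
    (cc : (P c)⁻¹ * Q c' ∈ H l) :
    wordDist X (P b) (Q b') ≤ C * (10 * K + 16) ∧
      wordDist X (P (b + 1)) (Q (b' + 1)) ≤ C * (10 * K + 16) := by
  have hbn : b < n := by omega
  have hbn' : b' < n := by omega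
  have hself : (P b)⁻¹ * P b ∈ H l := by simp
  constructor
  · have w1 := (hP.walk_left (M := 0) hab.le hbn lb hself).symm (AvoidEdge.symm hX)
    have w2 : Walk (AvoidEdge H X l (P b) 0) 1 (P a) (Q a') :=
      Walk.single (Or.inr ⟨l, ca, fun _ => Or.inl fun h =>
        hP.not_mem_of_lt hab hbn lb (inv_mul_mem_symm h)⟩)
    have w3 := hQ.walk_left (M := 0) hab'.le hbn' lb' cb
    exact hC.dist_le ((w1.trans w2).trans w3) hself cb (by omega)
  · have w1 := hP.walk_right (M := 0) hbc hc.le lb hself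
    have w2 : Walk (AvoidEdge H X l (P b) 0) 1 (P c) (Q c') :=
      Walk.single (Or.inr ⟨l, cc, fun _ => Or.inl (hP.not_mem_of_lt hbc hc lc)⟩)
    have w3 := (hQ.walk_right (M := 0) hbc' hc'.le lb' cb).symm (AvoidEdge.symm hX)
    exact hC.dist_le ((w1.trans w2).trans w3) (hP.h_edge b hbn l lb)
      (mul_inv_mem_trans cb (hQ.h_edge b' hbn' l lb')) (by omega)

end Pair

end RelHyp

namespace RelHyp

section Chain

variable {G : Type*} [Group G] {Λ : Type*} {H : Λ → Subgroup G} {X : Set G}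
variable {n K C : ℕ} {P Q : ℕ → G} {lab : ℕ → Option Λ} {l : Λ}

theorem wordDist_le_of_close (hX : Subgroup.closure X = ⊤) {u v u' v' : G} {B : ℕ}
    (hu : wordDist X u u' ≤ B) (hv : wordDist X v v' ≤ B) :
    wordDist X u v ≤ 2 * B + wordDist X u' v' := by
  have h1 := wordDist_triangle hX u u' v
  have h2 := wordDist_triangle hX u' v' v
  rw [wordDist_comm hX v' v] at h2
  omega

/-- In a symmetric pair, an edge connected to a later edge is short. -/
theorem IsPair.edge_le_of_lt (hX : Subgroup.closure X = ⊤) (hC : IsIsolatedBound H X C)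
    (h : IsPair H X K n P Q lab) {t : G} (hQ : ∀ i, Q i = t * P i) {a b : ℕ} (hab : a < b)
    (hb : b < n) (la : lab a = some l) (lb : lab b = some l) (hc : (P a)⁻¹ * Q b ∈ H l) :
    wordDist X (P a) (P (a + 1)) ≤ 7 * (C * (10 * K + 16)) := by
  have hedge : ∀ i j, (P i)⁻¹ * Q j ∈ H l → i < n → j < n → lab i = some l → lab j = some l →
      wordDist X (P i) (P (i + 1)) ≤
        2 * (C * (10 * K + 16)) + wordDist X (P j) (P (j + 1)) := by
    intro i j hij hi hj li lj
    obtain ⟨h1, h2⟩ := h.dist_le_of_connected hX hC hi hj li lj hij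
    have := wordDist_le_of_close hX h1 h2
    rwa [hQ j, hQ (j + 1), wordDist_mul_left] at this
  have hab' := hedge a b hc (by omega) hb la lb
  by_cases ea : wordDist X (P a) (P (a + 1)) ≤ C * (10 * K + 16)
  · omega
  by_cases eb : wordDist X (P b) (P (b + 1)) ≤ C * (10 * K + 16)
  · omega
  obtain ⟨c, hcn, lc, hcc⟩ := h.exists_connected hX hC hb lb (not_le.1 eb)
  have hbc := h.lt_of_connected hX hC hab hb hcn la lb (not_le.1 ea) hc hcc
  suffices key : ∀ N s a' b' c', n - c' ≤ N → a' < b' → b' < c' → c' < n →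
      lab b' = some l → lab c' = some l → (P a)⁻¹ * (s * P a') ∈ H l →
      (P b)⁻¹ * (s * P b') ∈ H l → (P c)⁻¹ * (s * P c') ∈ H l → (P a')⁻¹ * Q b' ∈ H l →
      (P b')⁻¹ * Q c' ∈ H l →
      wordDist X (P b) (P (b + 1)) ≤ 5 * (C * (10 * K + 16)) by
    have := key _ 1 a b c le_rfl hab hbc hcn lb lc (by simp) (by simp) (by simp) hc hcc
    omega
  intro N
  induction N with
  | zero =>
    intro s a' b' c' hN _ _ hc'
    omega
  | succ N ih =>
    intro s a' b' c' hN hab' hbc' hc' lb' lc' ca cb cc hc1 hc2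
    have hbb : wordDist X (P b) (P (b + 1)) ≤
        2 * (C * (10 * K + 16)) + wordDist X (P b') (P (b' + 1)) := by
      obtain ⟨h1, h2⟩ := dist_le_of_connected_triple hX hC h.left (h.left.mul_left s) hab hbc hcn
        hab' hbc' hc' (h.index_le hX (by omega) (by omega) hc).2
        (h.index_le hX (by omega) (by omega) hcc).2 (h.index_le hX (by omega) (by omega) hc1).2
        (h.index_le hX (by omega) (by omega) hc2).2 lb lc lb' ca cb cc
      have := wordDist_le_of_close hX h1 h2
      rwa [wordDist_mul_left] at this
    have hbc2 := hedge b' c' hc2 (by omega) hc' lb' lc'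
    by_cases eb' : wordDist X (P b') (P (b' + 1)) ≤ C * (10 * K + 16)
    · omega
    by_cases ec' : wordDist X (P c') (P (c' + 1)) ≤ C * (10 * K + 16)
    · omega
    obtain ⟨d', hd', ld', hdd⟩ := h.exists_connected hX hC hc' lc' (not_le.1 ec')
    have hcd := h.lt_of_connected hX hC hbc' hc' hd' lb' lc' (not_le.1 eb') hc2 hdd
    have hmove : ∀ x i j, x⁻¹ * (s * P i) ∈ H l → (P i)⁻¹ * Q j ∈ H l →
        x⁻¹ * (s * t * P j) ∈ H l := by
      intro x i j h1 h2
      have := (H l).mul_mem h1 h2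
      rw [hQ] at this
      simpa [mul_assoc] using this
    exact ih (s * t) b' c' d' (by omega) hbc' hcd hd' lc' ld' (hmove _ _ _ ca hc1)
      (hmove _ _ _ cb hc2) (hmove _ _ _ cc hdd) hc2 hdd

/-- In a symmetric pair, the corresponding endpoints of long edges are close. -/
theorem IsPair.dist_le_of_long (hX : Subgroup.closure X = ⊤) (hC : IsIsolatedBound H X C)
    (h : IsPair H X K n P Q lab) {t : G} (hQ : ∀ i, Q i = t * P i) {j : ℕ} (hj : j < n)
    (hlong : 9 * (C * (10 * K + 16)) + 1 < wordDist X (P j) (P (j + 1))) :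
    wordDist X (P (j + 1)) (Q (j + 1)) ≤ C * (10 * K + 16) := by
  rcases hl : lab j with _ | l
  · have := wordDist_le_one (h.left.x_edge j hj hl)
    omega
  obtain ⟨j', hj', hl', hc⟩ := h.exists_connected hX hC hj hl (by omega)
  obtain ⟨h1, h2⟩ := h.dist_le_of_connected hX hC hj hj' hl hl' hc
  rcases lt_trichotomy j j' with hlt | rfl | hlt
  · have := h.edge_le_of_lt hX hC hQ hlt hj' hl hl' hc
    omega
  · exact h2
  · have h3 := (h.symm hX).edge_le_of_lt hX hC (t := t⁻¹) (fun i => by simp [hQ i]) hlt hj hl' hl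
      (inv_mul_mem_symm hc)
    have h4 := wordDist_le_of_close hX h1 h2
    omega

/-- After a stretch of short edges, synchronous vertices of a symmetric pair are close. -/
theorem IsPair.dist_le_of_short (hX : Subgroup.closure X = ⊤) (hC : IsIsolatedBound H X C)
    (h : IsPair H X K n P Q lab) {t : G} (hQ : ∀ i, Q i = t * P i) {i M : ℕ} (hi : i ≤ n)
    (hshort : ∀ j, i - (2 * K + 3) ≤ j → j < i → wordDist X (P j) (P (j + 1)) ≤ M) :
    wordDist X (P i) (Q i) ≤ K * (M * (6 * K + 6) + C * (6 * K + 8) + 1) := by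
  have hS := closure_relGens (H := H) hX
  obtain ⟨c, lab', h0, h1, hc⟩ := exists_isGeod (H := H) hX (P i) (Q i)
  have hn := h.near i hi
  set ρ := wordDist (relGens H X) (P i) (Q i) with hρ
  have hstep : ∀ s < ρ, wordDist X (c s) (c (s + 1)) ≤ M * (6 * K + 6) + C * (6 * K + 8) + 1 := by
    intro s hs
    rcases hl : lab' s with _ | l
    · have := wordDist_le_one (hc.x_edge s hs hl)
      omega
    have hself : (c s)⁻¹ * c s ∈ H l := by simp
    have w1 := (hc.walk_left (M := M) (Nat.zero_le s) hs hl hself).symm (AvoidEdge.symm hX)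
    have w5 := (hc.walk_right (M := M) hs le_rfl hl hself).symm (AvoidEdge.symm hX)
    rw [h0] at w1
    rw [h1] at w5
    have w2 := (h.left.walk_avoid (l := l) (x := c s) (M := M) (a := i - (2 * K + 3))
      (by omega) hi fun j h2 h3 _ _ => hshort j h2 h3).symm (AvoidEdge.symm hX)
    have w4 := h.right.walk_avoid (l := l) (x := c s) (M := M) (a := i - (2 * K + 3))
      (by omega) hi fun j h2 h3 _ _ => by
        rw [hQ, hQ, wordDist_mul_left]
        exact hshort j h2 h3
    obtain ⟨r, hr, w3⟩ := h.exists_anchor hX (i := i - (2 * K + 3)) (by omega) (x := c s) (by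
      have h2 := hc.dist_eq 0 s (Nat.zero_le _) hs.le
      have h3 := wordDist_triangle hS (P i) (c s) (P (i - (2 * K + 3)))
      rw [wordDist_comm hS (P i) (P (i - (2 * K + 3))), h.left.dist_eq _ _ (by omega) hi] at h3
      rw [h0] at h2
      omega) l M
    have hb := hC l (c s) M _ _ _ ((((w1.trans w2).trans w3).trans w4).trans w5) hself
      (hc.h_edge s hs l hl)
    refine hb.trans (le_trans (add_le_add (Nat.mul_le_mul_left M ?_) (Nat.mul_le_mul_left C ?_))
      (Nat.le_succ _)) <;> omega
  have hsum : ∀ s ≤ ρ, wordDist X (P i) (c s) ≤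
      s * (M * (6 * K + 6) + C * (6 * K + 8) + 1) := by
    intro s
    induction s with
    | zero => simp [h0, wordDist_self]
    | succ s ih =>
      intro hs
      have h2 := ih (by omega)
      have h3 := hstep s hs
      have h4 := wordDist_triangle hX (P i) (c s) (c (s + 1))
      rw [Nat.succ_mul]
      omega
  have := hsum ρ le_rfl
  rw [h1] at this
  exact this.trans (Nat.mul_le_mul_right _ hn)

theorem exists_dist_le_of_isPair (hX : Subgroup.closure X = ⊤) (hC : IsIsolatedBound H X C)
    (K : ℕ) : ∃ κ : ℕ, ∀ n (P Q : ℕ → G) lab, IsPair H X K n P Q lab →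
      (∃ t, ∀ i, Q i = t * P i) → ∀ i ≤ n, wordDist X (P i) (Q i) ≤ κ := by
  obtain ⟨M, hM⟩ : ∃ M, M = 9 * (C * (10 * K + 16)) + 1 := ⟨_, rfl⟩
  refine ⟨(C * (10 * K + 16) + K + (2 * K + 3) * (2 * M)) +
    K * (M * (6 * K + 6) + C * (6 * K + 8) + 1), fun n P Q lab h ⟨t, hQ⟩ i hi => ?_⟩
  have key : ∀ r i, i ≤ n → wordDist X (P i) (Q i) ≤ C * (10 * K + 16) + K + r * (2 * M) ∨
      ∀ j, i - r ≤ j → j < i → wordDist X (P j) (P (j + 1)) ≤ M := by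
    intro r
    induction r with
    | zero => exact fun i _ => Or.inr fun j h1 h2 => by omega
    | succ r ih =>
      rintro (_ | i) hi
      · have := h.start
        left
        omega
      · by_cases hlong : wordDist X (P i) (P (i + 1)) ≤ M
        · rcases ih i (by omega) with h1 | h1
          · left
            have h2 := wordDist_triangle hX (P (i + 1)) (P i) (Q (i + 1))
            have h3 := wordDist_triangle hX (P i) (Q i) (Q (i + 1))
            rw [hQ i, hQ (i + 1), wordDist_mul_left, ← hQ i, ← hQ (i + 1)] at h3
            rw [wordDist_comm hX (P (i + 1)) (P i)] at h2
            rw [Nat.succ_mul r]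
            omega
          · right
            intro j h2 h3
            rcases Nat.lt_succ_iff_lt_or_eq.1 h3 with h4 | rfl
            · exact h1 j (by omega) h4
            · exact hlong
        · left
          have := h.dist_le_of_long hX hC hQ (j := i) (by omega) (by omega)
          omega
  rcases key (2 * K + 3) i hi with h1 | h1
  · exact h1.trans (Nat.le_add_right _ _)
  · exact (h.dist_le_of_short hX hC hQ hi h1).trans (Nat.le_add_left _ _)

end Chain

section Paths

variable {G : Type*} [Group G] {Λ : Type*} {H : Λ → Subgroup G} {X : Set G}

theorem IsGeodesic.isGeod {p : RelPath H X} (hp : IsGeodesic p) :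
    IsGeod H X p.len p.vertex fun i => p.word[i]?.bind RelLetter.hIndex := by
  have hstep : ∀ i (hi : i < p.word.length),
      (p.vertex i)⁻¹ * p.vertex (i + 1) = (p.word[i]).val := by
    intro i hi
    have : i < (p.word.map RelLetter.val).length := by simpa using hi
    have h := List.prod_take_succ (p.word.map RelLetter.val) i this
    simp only [RelPath.vertex, List.map_take, h]
    simp [mul_assoc]
  refine ⟨fun i hi l hl => ?_, fun i hi hl => ?_, fun i j hij hj => (hp i j hij hj).symm⟩
  · have hi' : i < p.word.length := hi
    rw [hstep i hi']
    rw [List.getElem?_eq_getElem hi'] at hl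
    rcases hw : p.word[i] with ⟨μ, g⟩ | ⟨x, b⟩
    · simp only [hw, Option.bind_some, RelLetter.hIndex, Option.some.injEq] at hl
      subst hl
      exact g.1.2
    · simp [hw, RelLetter.hIndex] at hl
  · have hi' : i < p.word.length := hi
    rw [hstep i hi']
    rw [List.getElem?_eq_getElem hi'] at hl
    rcases hw : p.word[i] with ⟨μ, g⟩ | ⟨x, b⟩
    · simp [hw, RelLetter.hIndex] at hl
    · cases b <;> simp [RelLetter.val]

end Paths

end RelHyp

open RelHyp

/-- Theorem 3.34. Let `G` be generated by a finite set `X` and hyperbolic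
relative to `{H₁,…,H_m}`. For any `k ≥ 0` there is `κ = κ(k)` such that for every symmetric pair
`(p, q)` of `k`-similar geodesics in `Γ(G, X ∪ 𝓗)` and every pair of synchronous vertices
`u ∈ p`, `v ∈ q`, one has `dist_X(u, v) ≤ κ`. -/
theorem statement_11 {G : Type*} [Group G] {m : ℕ} (H : Fin m → Subgroup G)
    (X : Set G) (hXfin : X.Finite) (hXgen : Subgroup.closure X = ⊤)
    (hhyp : IsRelHyperbolic H) :
    ∀ k : ℝ, 0 ≤ k → ∃ κ : ℝ,
      ∀ p q : RelPath H X, IsGeodesic p → IsGeodesic q → p.word = q.word →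
        Similar k p q →
        ∀ i ≤ p.len, (xDist X (p.vertex i) (q.vertex i) : ℝ) ≤ κ := by
  intro k hk
  obtain ⟨C, hC⟩ := exists_isolated_bound hXgen hXfin hhyp
  obtain ⟨K, hkK, hK⟩ := exists_fellow_travel hXgen hXfin hhyp ⌊k⌋₊
  obtain ⟨κ, hκ⟩ := exists_dist_le_of_isPair hXgen hC K
  refine ⟨κ, fun p q hp hq hpq hs i hi => Nat.cast_le.2 ?_⟩
  have hstart : wordDist X (p.vertex 0) (q.vertex 0) ≤ ⌊k⌋₊ := by
    have := Nat.le_floor hs.1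
    simp only [RelPath.vertex, List.take_zero, List.map_nil, List.prod_nil, mul_one]
    exact this
  have hfinish : wordDist X (p.vertex p.len) (q.vertex p.len) ≤ ⌊k⌋₊ := by
    have := Nat.le_floor hs.2
    simp only [RelPath.finish, ← hpq] at this
    exact this
  have hp' := hp.isGeod
  have hq' := hq.isGeod
  rw [RelPath.len, ← hpq] at hq'
  have hpair : IsPair H X K p.len p.vertex q.vertex _ :=
    ⟨hp', hq', hK _ _ _ _ _ hp' hq' ((relGens_dist_le hXgen _ _).trans hstart)
      ((relGens_dist_le hXgen _ _).trans hfinish), hstart.trans hkK, hfinish.trans hkK⟩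
  exact hκ _ _ _ _ hpair ⟨q.start * p.start⁻¹, fun j => by simp [RelPath.vertex, hpq, mul_assoc]⟩
    i hi
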